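/- Let G be a connected finite graph on n vertices and let P be a set of exactly 3 longest paths of G. Then 17·f(G,P) ≤ n. -/

import Mathlib

open SimpleGraph

/-- `w` is a longest path of `G`: it is a path and no path of `G` is longer. -/
def IsLongestPath {V : Type*} (G : SimpleGraph V) {u v : V} (w : G.Walk u v) : Prop :=
  w.IsPath ∧ ∀ (a b : V) (q : G.Walk a b), q.IsPath → q.length ≤ w.length

/-- The distance `d_G(x, V(w))` from a vertex `x` to the vertex set of a walk `w`. -/
noncomputable def distToWalk {V : Type*} (G : SimpleGraph V) (x : V) {u v : V}
    (w : G.Walk u v) : ℕ :=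
  sInf {d : ℕ | ∃ y ∈ w.support, G.dist x y = d}

/-- The path-distance-function `f(G, 𝒫)` of a family `𝒫` of paths of `G`. -/
noncomputable def pdf {V : Type*} (G : SimpleGraph V) {k : ℕ}
    (P : Fin k → Σ u : V, Σ v : V, G.Walk u v) : ℕ :=
  sInf {s : ℕ | ∃ x : V, s = ∑ i, distToWalk G x (P i).2.2}

/-- There is a path of `G` from `u` to `v` with at least `n` edges and all vertices in `S`. -/
def PathWithin {V : Type*} (G : SimpleGraph V) (u v : V) (n : ℕ) (S : Set V) : Prop :=
  ∃ w : G.Walk u v, w.IsPath ∧ n ≤ w.length ∧ ∀ x ∈ w.support, x ∈ S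

namespace PathWithin

variable {V : Type*} {G : SimpleGraph V} {u v w x : V} {m n : ℕ} {S T : Set V}

lemma mono (h : PathWithin G u v n S) (hm : m ≤ n) (hST : ∀ y ∈ S, y ∈ T) :
    PathWithin G u v m T := by
  obtain ⟨p, hp, hn, hS⟩ := h
  exact ⟨p, hp, hm.trans hn, fun y hy => hST y (hS y hy)⟩

lemma symm (h : PathWithin G u v n S) : PathWithin G v u n S := by
  obtain ⟨p, hp, hn, hS⟩ := h
  exact ⟨p.reverse, hp.reverse, by simpa using hn, by simpa using hS⟩

lemma left_mem (h : PathWithin G u v n S) : u ∈ S := by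
  obtain ⟨p, -, -, hS⟩ := h
  exact hS u p.start_mem_support

lemma right_mem (h : PathWithin G u v n S) : v ∈ S := h.symm.left_mem

/-- Two paths that share nothing but the end of the first and the start of the second. -/
lemma glue (h₁ : PathWithin G u v m S) (h₂ : PathWithin G v w n T)
    (hST : ∀ y ∈ S, y ∈ T → y = v) : PathWithin G u w (m + n) (S ∪ T) := by
  obtain ⟨p, hp, hm, hS⟩ := h₁
  obtain ⟨q, hq, hn, hT⟩ := h₂
  refine ⟨p.append q, ?_, by rw [Walk.length_append]; omega, ?_⟩
  · rw [Walk.isPath_def, Walk.support_append, List.nodup_append]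
    have hq' := hq.support_nodup
    rw [← q.cons_tail_support, List.nodup_cons] at hq'
    refine ⟨hp.support_nodup, hq'.2, ?_⟩
    rintro a ha b hb rfl
    have := hST a (hS a ha) (hT a (List.mem_of_mem_tail hb))
    exact hq'.1 (this ▸ hb)
  · intro y hy
    rcases (Walk.mem_support_append_iff _ _).1 hy with hy | hy
    · exact Or.inl (hS y hy)
    · exact Or.inr (hT y hy)

/-- Two disjoint paths joined by an edge. -/
lemma link (h₁ : PathWithin G u v m S) (hvw : G.Adj v w) (h₂ : PathWithin G w x n T)
    (hST : ∀ y ∈ S, y ∉ T) : PathWithin G u x (m + 1 + n) (S ∪ T) := by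
  have hv := h₁.right_mem
  have hw := h₂.left_mem
  have e : PathWithin G v w 1 {v, w} := ⟨hvw.toWalk, by simpa using hvw.ne, by simp, by simp⟩
  have h₃ := h₁.glue e (by
    rintro y hy (rfl | rfl)
    · rfl
    · exact absurd hw (hST _ hy))
  refine (h₃.glue h₂ ?_).mono le_rfl ?_
  · rintro y (hy | rfl | rfl) hy'
    · exact absurd hy' (hST _ hy)
    · exact absurd hy' (hST _ hv)
    · rfl
  · rintro y ((hy | rfl | rfl) | hy)
    exacts [Or.inl hy, Or.inl hv, Or.inr hw, Or.inr hy]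

lemma nil (u : V) : PathWithin G u u 0 {u} := ⟨Walk.nil, by simp, by simp, by simp⟩

end PathWithin

/-- `v` is one of `p 0, …, p ℓ`. -/
def OnSeq {V : Type*} (ℓ : ℕ) (p : ℕ → V) (v : V) : Prop := ∃ t ≤ ℓ, p t = v

/-- `p 0, …, p ℓ` are the consecutive vertices of a longest path of `G`. -/
structure IsLongestSeq {V : Type*} (G : SimpleGraph V) (ℓ : ℕ) (p : ℕ → V) : Prop where
  inj : ∀ s ≤ ℓ, ∀ t ≤ ℓ, p s = p t → s = t
  adj : ∀ t < ℓ, G.Adj (p t) (p (t + 1))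
  long : ∀ u v n S, PathWithin G u v n S → n ≤ ℓ

namespace IsLongestSeq

variable {V : Type*} {G : SimpleGraph V} {ℓ : ℕ} {p : ℕ → V}

lemma rev (hp : IsLongestSeq G ℓ p) : IsLongestSeq G ℓ (fun t => p (ℓ - t)) where
  inj s hs t ht h := by
    have := hp.inj _ (by omega) _ (by omega) h
    omega
  adj t ht := by
    have := hp.adj (ℓ - (t + 1)) (by omega)
    rw [show ℓ - (t + 1) + 1 = ℓ - t by omega] at this
    exact this.symm
  long := hp.long

lemma seg_of_le (hp : IsLongestSeq G ℓ p) {a b : ℕ} (hab : a ≤ b) (hb : b ≤ ℓ) :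
    PathWithin G (p a) (p b) (b - a) (p '' Set.Icc a b) := by
  induction b, hab using Nat.le_induction with
  | base => simpa using PathWithin.nil (p a)
  | succ b hab ih =>
    refine ((ih (by omega)).link (hp.adj b (by omega)) (.nil _) ?_).mono (by omega) ?_
    · rintro _ ⟨t, ⟨h₁, h₂⟩, rfl⟩ h
      have := hp.inj _ (by omega) _ hb h
      omega
    · rintro _ (⟨t, ⟨h₁, h₂⟩, rfl⟩ | rfl)
      · exact ⟨t, ⟨h₁, by omega⟩, rfl⟩
      · exact ⟨b + 1, ⟨by omega, le_rfl⟩, rfl⟩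

/-- The segment of a longest path between two of its vertices, in either direction. -/
lemma seg (hp : IsLongestSeq G ℓ p) {a b : ℕ} (ha : a ≤ ℓ) (hb : b ≤ ℓ) :
    PathWithin G (p a) (p b) ((a - b) + (b - a))
      {v | ∃ t, ((a ≤ t ∧ t ≤ b) ∨ (b ≤ t ∧ t ≤ a)) ∧ p t = v} := by
  rcases le_total a b with h | h
  · refine (hp.seg_of_le h hb).mono (by omega) ?_
    rintro _ ⟨t, ⟨h₁, h₂⟩, rfl⟩
    exact ⟨t, Or.inl ⟨h₁, h₂⟩, rfl⟩
  · refine (hp.seg_of_le h ha).symm.mono (by omega) ?_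
    rintro _ ⟨t, ⟨h₁, h₂⟩, rfl⟩
    exact ⟨t, Or.inr ⟨h₁, h₂⟩, rfl⟩

/-- A path leaving a longest path is at most as long as either side of the longest path. -/
lemma half_ear (hp : IsLongestSeq G ℓ p) {a n : ℕ} (ha : a ≤ ℓ) {u : V} {T : Set V}
    (h : PathWithin G (p a) u n T) (hT : ∀ x ∈ T, OnSeq ℓ p x → x = p a) :
    n ≤ a ∧ n + a ≤ ℓ := by
  constructor
  · have := hp.long _ _ _ _ ((hp.seg (le_refl ℓ) ha).glue h (by
      rintro _ ⟨t, ht, rfl⟩ hx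
      exact hT _ hx ⟨t, by omega, rfl⟩))
    omega
  · have := hp.long _ _ _ _ ((hp.seg (Nat.zero_le ℓ) ha).glue h (by
      rintro _ ⟨t, ht, rfl⟩ hx
      exact hT _ hx ⟨t, by omega, rfl⟩))
    omega

lemma ear_of_lt (hp : IsLongestSeq G ℓ p) {a m n : ℕ} (ham : a < m) (hm : m ≤ ℓ) {T : Set V}
    (h : PathWithin G (p a) (p m) n T) (hT : ∀ x ∈ T, OnSeq ℓ p x → x = p a ∨ x = p m) :
    n ≤ m - a := by
  have h₁ := (hp.seg (Nat.zero_le ℓ) (show a ≤ ℓ by omega)).glue h (by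
    rintro _ ⟨t, ht, rfl⟩ hx
    rcases hT _ hx ⟨t, by omega, rfl⟩ with h | h
    · exact h
    · have := hp.inj _ (by omega) _ hm h
      omega)
  have := hp.long _ _ _ _ (h₁.glue (hp.seg hm (le_refl ℓ)) (by
    rintro _ (⟨t, ht, rfl⟩ | hx) ⟨t', ht', h⟩
    · have := hp.inj _ (by omega) _ (by omega) h
      omega
    · rcases hT _ hx ⟨t', by omega, h⟩ with h' | h'
      · have := hp.inj _ (by omega) _ (by omega) (h.trans h')
        omega
      · exact h'))
  omega

/-- A path that leaves a longest path and returns to it is no longer than the part it skips. -/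
lemma ear (hp : IsLongestSeq G ℓ p) {a m n : ℕ} (ha : a ≤ ℓ) (hm : m ≤ ℓ) (ham : a ≠ m)
    {T : Set V} (h : PathWithin G (p a) (p m) n T)
    (hT : ∀ x ∈ T, OnSeq ℓ p x → x = p a ∨ x = p m) :
    n ≤ (a - m) + (m - a) := by
  rcases lt_or_gt_of_ne ham with h' | h'
  · have := hp.ear_of_lt h' hm h hT
    omega
  · have := hp.ear_of_lt h' ha h.symm (fun x hx hx' => (hT x hx hx').symm)
    omega

end IsLongestSeq

/-- Three longest paths such that, along each of them, vertices shared with the second and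
vertices shared with the third are at least `k` apart. -/
structure SpreadTriple {V : Type*} (G : SimpleGraph V) (ℓ k : ℕ) (p q r : ℕ → V) : Prop where
  pos : 1 ≤ k
  fst : IsLongestSeq G ℓ p
  snd : IsLongestSeq G ℓ q
  trd : IsLongestSeq G ℓ r
  gap_fst : ∀ s ≤ ℓ, ∀ t ≤ ℓ, OnSeq ℓ q (p s) → OnSeq ℓ r (p t) → k ≤ (s - t) + (t - s)
  gap_snd : ∀ s ≤ ℓ, ∀ t ≤ ℓ, OnSeq ℓ p (q s) → OnSeq ℓ r (q t) → k ≤ (s - t) + (t - s)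
  gap_trd : ∀ s ≤ ℓ, ∀ t ≤ ℓ, OnSeq ℓ p (r s) → OnSeq ℓ q (r t) → k ≤ (s - t) + (t - s)
  meet_fst_snd : ∃ s ≤ ℓ, ∃ t ≤ ℓ, p s = q t
  meet_fst_trd : ∃ s ≤ ℓ, ∃ t ≤ ℓ, p s = r t
  meet_snd_trd : ∃ s ≤ ℓ, ∃ t ≤ ℓ, q s = r t

lemma onSeq_rev {V : Type*} {ℓ : ℕ} {p : ℕ → V} {v : V} :
    OnSeq ℓ (fun t => p (ℓ - t)) v ↔ OnSeq ℓ p v := by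
  constructor
  · rintro ⟨t, ht, rfl⟩
    exact ⟨ℓ - t, by omega, rfl⟩
  · rintro ⟨t, ht, rfl⟩
    exact ⟨ℓ - t, by omega, by simp only; congr 1; omega⟩

namespace SpreadTriple

variable {V : Type*} {G : SimpleGraph V} {ℓ k : ℕ} {p q r : ℕ → V}

lemma swap (h : SpreadTriple G ℓ k p q r) : SpreadTriple G ℓ k q p r where
  pos := h.pos
  fst := h.snd
  snd := h.fst
  trd := h.trd
  gap_fst := h.gap_snd
  gap_snd := h.gap_fst
  gap_trd s hs t ht h₁ h₂ := by
    have := h.gap_trd t ht s hs h₂ h₁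
    omega
  meet_fst_snd := by
    obtain ⟨s, hs, t, ht, e⟩ := h.meet_fst_snd
    exact ⟨t, ht, s, hs, e.symm⟩
  meet_fst_trd := h.meet_snd_trd
  meet_snd_trd := h.meet_fst_trd

lemma swap_snd_trd (h : SpreadTriple G ℓ k p q r) : SpreadTriple G ℓ k p r q where
  pos := h.pos
  fst := h.fst
  snd := h.trd
  trd := h.snd
  gap_fst s hs t ht h₁ h₂ := by
    have := h.gap_fst t ht s hs h₂ h₁
    omega
  gap_snd := h.gap_trd
  gap_trd := h.gap_snd
  meet_fst_snd := h.meet_fst_trd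
  meet_fst_trd := h.meet_fst_snd
  meet_snd_trd := by
    obtain ⟨s, hs, t, ht, e⟩ := h.meet_snd_trd
    exact ⟨t, ht, s, hs, e.symm⟩

lemma rev (h : SpreadTriple G ℓ k p q r) : SpreadTriple G ℓ k (fun t => p (ℓ - t)) q r where
  pos := h.pos
  fst := h.fst.rev
  snd := h.snd
  trd := h.trd
  gap_fst s hs t ht h₁ h₂ := by
    have := h.gap_fst (ℓ - s) (by omega) (ℓ - t) (by omega) h₁ h₂
    omega
  gap_snd s hs t ht h₁ h₂ := h.gap_snd s hs t ht (onSeq_rev.1 h₁) h₂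
  gap_trd s hs t ht h₁ h₂ := h.gap_trd s hs t ht (onSeq_rev.1 h₁) h₂
  meet_fst_snd := by
    obtain ⟨s, hs, t, ht, e⟩ := h.meet_fst_snd
    exact ⟨ℓ - s, by omega, t, ht, by simpa [Nat.sub_sub_self hs] using e⟩
  meet_fst_trd := by
    obtain ⟨s, hs, t, ht, e⟩ := h.meet_fst_trd
    exact ⟨ℓ - s, by omega, t, ht, by simpa [Nat.sub_sub_self hs] using e⟩
  meet_snd_trd := h.meet_snd_trd

/-- No vertex lies on all three paths. -/
lemma not_on_all (h : SpreadTriple G ℓ k p q r) {v : V} (hp : OnSeq ℓ p v) (hq : OnSeq ℓ q v)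
    (hr : OnSeq ℓ r v) : False := by
  obtain ⟨t, ht, rfl⟩ := hp
  have := h.gap_fst t ht t ht hq hr
  have := h.pos
  omega

end SpreadTriple

lemma exists_last_lt {A : ℕ → Prop} {a s : ℕ} (hs : s < a) (hA : A s) :
    ∃ i, s ≤ i ∧ i < a ∧ A i ∧ ∀ j, i < j → j < a → ¬ A j := by
  classical
  obtain ⟨i, hi, hmax⟩ := Finset.exists_max_image ((Finset.range a).filter A) id
    ⟨s, by simp [hs, hA]⟩
  simp only [Finset.mem_filter, Finset.mem_range, id] at hi hmax
  refine ⟨i, hmax s ⟨hs, hA⟩, hi.1, hi.2, fun j hij hj hAj => ?_⟩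
  have := hmax j ⟨hj, hAj⟩
  omega

lemma exists_first_gt {A : ℕ → Prop} {a s : ℕ} (hs : a < s) (hA : A s) :
    ∃ i, a < i ∧ i ≤ s ∧ A i ∧ ∀ j, a < j → j < i → ¬ A j := by
  classical
  have hex : ∃ i, a < i ∧ A i := ⟨s, hs, hA⟩
  exact ⟨Nat.find hex, (Nat.find_spec hex).1, Nat.find_min' hex ⟨hs, hA⟩, (Nat.find_spec hex).2,
    fun j hj hlt hAj => Nat.find_min hex hlt ⟨hj, hAj⟩⟩

/-- Consecutive occurrences of two properties. -/
lemma exists_consecutive {A B : ℕ → Prop} {s t : ℕ} (hst : s < t) (hA : A s) (hB : B t) :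
    ∃ s' t', s ≤ s' ∧ s' < t' ∧ t' ≤ t ∧ A s' ∧ B t' ∧
      ∀ i, s' < i → i < t' → ¬ A i ∧ ¬ B i := by
  obtain ⟨s', h₁, h₂, h₃, h₄⟩ := exists_last_lt hst hA
  obtain ⟨t', h₅, h₆, h₇, h₈⟩ := exists_first_gt h₂ hB
  exact ⟨s', t', h₁, h₅, h₆, h₃, h₇, fun i hi hi' => ⟨h₄ i hi (by omega), h₈ i hi hi'⟩⟩

/-- `p a` is the first vertex of `p` on `q`, and some earlier vertex of `p` lies on `r`. -/
def IsFirstAfter {V : Type*} (ℓ : ℕ) (p q r : ℕ → V) (a : ℕ) : Prop :=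
  a ≤ ℓ ∧ OnSeq ℓ q (p a) ∧ (∀ i < a, ¬ OnSeq ℓ q (p i)) ∧ ∃ i < a, OnSeq ℓ r (p i)

/-- The paths `p` and `q` cross at `p a = q b`; `p x₁`, `p x₂`, `q z₁`, `q z₂` are the vertices of
`r` nearest to the crossing on either side. -/
structure IsCrossing {V : Type*} (G : SimpleGraph V) (ℓ k : ℕ) (p q r : ℕ → V)
    (a b x₁ x₂ z₁ z₂ : ℕ) : Prop extends SpreadTriple G ℓ k p q r where
  cross : p a = q b
  x₁_lt : x₁ < a
  lt_x₂ : a < x₂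
  x₂_le : x₂ ≤ ℓ
  z₁_lt : z₁ < b
  lt_z₂ : b < z₂
  z₂_le : z₂ ≤ ℓ
  on_x₁ : OnSeq ℓ r (p x₁)
  on_x₂ : OnSeq ℓ r (p x₂)
  on_z₁ : OnSeq ℓ r (q z₁)
  on_z₂ : OnSeq ℓ r (q z₂)
  off_x : ∀ t, x₁ < t → t < x₂ → ¬ OnSeq ℓ r (p t)
  off_z : ∀ t, z₁ < t → t < z₂ → ¬ OnSeq ℓ r (q t)

namespace SpreadTriple

variable {V : Type*} {G : SimpleGraph V} {ℓ k : ℕ} {p q r : ℕ → V}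

lemma exists_isFirstAfter (h : SpreadTriple G ℓ k p q r) :
    (∃ a, IsFirstAfter ℓ p q r a) ∨ ∃ a, IsFirstAfter ℓ p r q a := by
  classical
  obtain ⟨s, hs, s', hs', es⟩ := h.meet_fst_snd
  obtain ⟨t, ht, t', ht', et⟩ := h.meet_fst_trd
  have hq : ∃ i, OnSeq ℓ q (p i) := ⟨s, s', hs', es.symm⟩
  have hr : ∃ i, OnSeq ℓ r (p i) := ⟨t, t', ht', et.symm⟩
  have hqs : Nat.find hq ≤ s := Nat.find_min' hq ⟨s', hs', es.symm⟩
  have hrt : Nat.find hr ≤ t := Nat.find_min' hr ⟨t', ht', et.symm⟩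
  rcases lt_trichotomy (Nat.find hr) (Nat.find hq) with hlt | heq | hlt
  · exact Or.inl ⟨_, hqs.trans hs, Nat.find_spec hq, fun i hi => Nat.find_min hq hi, _, hlt,
      Nat.find_spec hr⟩
  · exact (h.not_on_all ⟨_, hqs.trans hs, rfl⟩ (Nat.find_spec hq)
      (heq ▸ Nat.find_spec hr)).elim
  · exact Or.inr ⟨_, hrt.trans ht, Nat.find_spec hr, fun i hi => Nat.find_min hr hi, _, hlt,
      Nat.find_spec hq⟩

lemma le_of_isFirstAfter (h : SpreadTriple G ℓ k p q r) {a b : ℕ} (ha : IsFirstAfter ℓ p q r a)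
    (hb : b ≤ ℓ) (hab : q b = p a) : a ≤ b ∧ a + b ≤ ℓ := by
  have hpath := h.fst.seg ha.1 (Nat.zero_le ℓ)
  rw [← hab] at hpath
  have := h.snd.half_ear hb hpath (by
    rintro _ ⟨t, ht, rfl⟩ hx
    by_cases hta : t = a
    · rw [hta, hab]
    · exact (ha.2.2.1 t (by omega) hx).elim)
  omega

lemma exists_gt_of_isFirstAfter (h : SpreadTriple G ℓ k p q r) {a : ℕ}
    (ha : IsFirstAfter ℓ p q r a) : ∃ i, a < i ∧ i ≤ ℓ ∧ OnSeq ℓ r (p i) := by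
  by_contra! hno
  obtain ⟨b, hb, hab⟩ := ha.2.1
  have hle := h.le_of_isFirstAfter ha hb hab
  obtain ⟨i, hi, hir⟩ := ha.2.2.2
  obtain ⟨x, -, hxa, ⟨d, hd, hdx⟩, hx⟩ := exists_last_lt (A := fun i => OnSeq ℓ r (p i)) hi hir
  have hal := ha.1
  have hpath := h.fst.seg (show x ≤ ℓ by omega) le_rfl
  rw [← hdx] at hpath
  have := h.trd.half_ear hd hpath (by
    rintro _ ⟨t, ht, rfl⟩ hon
    rcases lt_trichotomy t x with htx | rfl | htx
    · omega
    · exact hdx.symm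
    · rcases lt_trichotomy t a with hta | rfl | hta
      · exact (hx t htx hta hon).elim
      · exact (h.not_on_all ⟨t, hal, rfl⟩ ha.2.1 hon).elim
      · exact (hno t hta (by omega) hon).elim)
  omega

lemma isFirstAfter_next (h : SpreadTriple G ℓ k p q r) {a b : ℕ} (ha : IsFirstAfter ℓ p q r a)
    (hb : b ≤ ℓ) (hab : q b = p a) (hno : ∀ i < b, ¬ OnSeq ℓ r (q i)) :
    ∃ c, a < c ∧ IsFirstAfter ℓ q r p c := by
  have hle := h.le_of_isFirstAfter ha hb hab
  obtain ⟨s, hs, s', hs', e⟩ := h.meet_snd_trd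
  have hbno : ¬ OnSeq ℓ r (q b) := fun hon =>
    h.not_on_all ⟨a, ha.1, hab.symm⟩ ⟨b, hb, rfl⟩ hon
  have hsr : OnSeq ℓ r (q s) := ⟨s', hs', e.symm⟩
  have hbs : b < s := by
    rcases lt_trichotomy s b with h' | rfl | h'
    · exact (hno s h' hsr).elim
    · exact (hbno hsr).elim
    · exact h'
  obtain ⟨c, hbc, hcs, hc, hmin⟩ := exists_first_gt (A := fun i => OnSeq ℓ r (q i)) hbs hsr
  refine ⟨c, by omega, by omega, hc, fun i hi hon => ?_, b, hbc, a, ha.1, hab.symm⟩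
  rcases lt_trichotomy i b with h' | rfl | h'
  · exact hno i h' hon
  · exact hbno hon
  · exact hmin i h' hi hon

lemma exists_crossing_of_isFirstAfter (N : ℕ) {p q r : ℕ → V} (h : SpreadTriple G ℓ k p q r)
    {a : ℕ} (ha : IsFirstAfter ℓ p q r a) (hN : ℓ - a ≤ N) :
    ∃ p q r a b x₁ x₂ z₁ z₂, IsCrossing G ℓ k p q r a b x₁ x₂ z₁ z₂ := by
  induction N generalizing p q r a with
  | zero =>
    obtain ⟨i, hi, hi', -⟩ := h.exists_gt_of_isFirstAfter ha
    omega
  | succ N ih =>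
    obtain ⟨b, hb, hab⟩ := ha.2.1
    by_cases hlow : ∃ i < b, OnSeq ℓ r (q i)
    swap
    · push Not at hlow
      obtain ⟨c, hac, hc⟩ := h.isFirstAfter_next ha hb hab hlow
      exact ih h.swap.swap_snd_trd hc (by omega)
    by_cases hhigh : ∃ i, b < i ∧ i ≤ ℓ ∧ OnSeq ℓ r (q i)
    swap
    · push Not at hhigh
      have h' := h.swap.rev.swap
      have ha' : IsFirstAfter ℓ p (fun t => q (ℓ - t)) r a :=
        ⟨ha.1, onSeq_rev.2 ha.2.1, fun i hi hon => ha.2.2.1 i hi (onSeq_rev.1 hon), ha.2.2.2⟩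
      obtain ⟨c, hac, hc⟩ := h'.isFirstAfter_next ha' (Nat.sub_le ℓ b)
        (by simpa [Nat.sub_sub_self hb] using hab)
        (fun i hi => hhigh (ℓ - i) (by omega) (Nat.sub_le ℓ i))
      exact ih h'.swap.swap_snd_trd hc (by omega)
    obtain ⟨i₁, hi₁, hr₁⟩ := ha.2.2.2
    obtain ⟨i₂, hi₂, hi₂', hr₂⟩ := h.exists_gt_of_isFirstAfter ha
    obtain ⟨j₁, hj₁, hs₁⟩ := hlow
    obtain ⟨j₂, hj₂, hj₂', hs₂⟩ := hhigh
    obtain ⟨x₁, -, hx₁, hx₁r, hx₁'⟩ :=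
      exists_last_lt (A := fun i => OnSeq ℓ r (p i)) hi₁ hr₁
    obtain ⟨x₂, hx₂, hx₂i, hx₂r, hx₂'⟩ :=
      exists_first_gt (A := fun i => OnSeq ℓ r (p i)) hi₂ hr₂
    obtain ⟨z₁, -, hz₁, hz₁r, hz₁'⟩ :=
      exists_last_lt (A := fun i => OnSeq ℓ r (q i)) hj₁ hs₁
    obtain ⟨z₂, hz₂, hz₂j, hz₂r, hz₂'⟩ :=
      exists_first_gt (A := fun i => OnSeq ℓ r (q i)) hj₂ hs₂
    have hy : ¬ OnSeq ℓ r (p a) := fun hon => h.not_on_all ⟨a, ha.1, rfl⟩ ha.2.1 hon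
    refine ⟨p, q, r, a, b, x₁, x₂, z₁, z₂, h, hab.symm, hx₁, hx₂, by omega, hz₁, hz₂, by omega,
      hx₁r, hx₂r, hz₁r, hz₂r, fun t ht ht' => ?_, fun t ht ht' => ?_⟩
    · rcases lt_trichotomy t a with h' | rfl | h'
      exacts [hx₁' t ht h', hy, hx₂' t h' ht']
    · rcases lt_trichotomy t b with h' | rfl | h'
      exacts [hz₁' t ht h', hab ▸ hy, hz₂' t h' ht']

theorem exists_crossing (h : SpreadTriple G ℓ k p q r) :
    ∃ p q r a b x₁ x₂ z₁ z₂, IsCrossing G ℓ k p q r a b x₁ x₂ z₁ z₂ := by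
  rcases h.exists_isFirstAfter with ⟨a, ha⟩ | ⟨a, ha⟩
  · exact exists_crossing_of_isFirstAfter _ h ha le_rfl
  · exact exists_crossing_of_isFirstAfter _ h.swap_snd_trd ha le_rfl

end SpreadTriple

/-- There is a path from `u` through `S` with at least `n` edges whose end is adjacent to `v`. -/
def Bridge {V : Type*} (G : SimpleGraph V) (S : Set V) (n : ℕ) (u v : V) : Prop :=
  ∃ w, PathWithin G u w n (insert u S) ∧ G.Adj w v

namespace Bridge

variable {V : Type*} {G : SimpleGraph V} {S T : Set V} {m n ℓ : ℕ} {u v : V} {r : ℕ → V}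

lemma mono (h : Bridge G S n u v) (hm : m ≤ n) (hST : ∀ x ∈ S, x ∈ T) : Bridge G T m u v := by
  obtain ⟨w, hw, ha⟩ := h
  refine ⟨w, hw.mono hm ?_, ha⟩
  rintro x (rfl | hx)
  exacts [Or.inl rfl, Or.inr (hST x hx)]

lemma path (h : Bridge G S n u v) (huv : u ≠ v) (hv : v ∉ S) :
    PathWithin G u v (n + 1) (insert u S ∪ {v}) := by
  obtain ⟨w, hw, ha⟩ := h
  refine (hw.link ha (.nil v) ?_).mono le_rfl fun _ h => h
  rintro x (rfl | hx) rfl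
  exacts [huv rfl, hv hx]

lemma half_ear (hr : IsLongestSeq G ℓ r) (hS : ∀ x ∈ S, ¬ OnSeq ℓ r x) {i : ℕ} (hi : i ≤ ℓ)
    (h : Bridge G S n (r i) v) : n ≤ i ∧ n + i ≤ ℓ := by
  obtain ⟨w, hw, -⟩ := h
  refine hr.half_ear hi hw ?_
  rintro x (rfl | hx) hon
  exacts [rfl, (hS x hx hon).elim]

lemma ear (hr : IsLongestSeq G ℓ r) (hS : ∀ x ∈ S, ¬ OnSeq ℓ r x) {i j : ℕ} (hi : i ≤ ℓ)
    (hj : j ≤ ℓ) (hij : i ≠ j) (h : Bridge G S n (r i) (r j)) : n + 1 ≤ (i - j) + (j - i) := by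
  refine hr.ear hi hj hij (h.path (fun e => hij (hr.inj _ hi _ hj e))
    fun hjS => hS _ hjS ⟨j, hj, rfl⟩) ?_
  rintro x ((rfl | hx) | rfl) hon
  exacts [Or.inl rfl, (hS x hx hon).elim, Or.inr rfl]

end Bridge

/-- The vertices of `p` strictly between `p x₁` and `p x₂` and of `q` strictly between `q z₁` and
`q z₂`. -/
def crossCore {V : Type*} (p q : ℕ → V) (x₁ x₂ z₁ z₂ : ℕ) : Set V :=
  {v | (∃ t, (x₁ < t ∧ t < x₂) ∧ p t = v) ∨ ∃ t, (z₁ < t ∧ t < z₂) ∧ q t = v}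

namespace IsCrossing

variable {V : Type*} {G : SimpleGraph V} {ℓ k a b x₁ x₂ z₁ z₂ : ℕ} {p q r : ℕ → V}

lemma swap (h : IsCrossing G ℓ k p q r a b x₁ x₂ z₁ z₂) :
    IsCrossing G ℓ k q p r b a z₁ z₂ x₁ x₂ where
  toSpreadTriple := h.toSpreadTriple.swap
  cross := h.cross.symm
  x₁_lt := h.z₁_lt
  lt_x₂ := h.lt_z₂
  x₂_le := h.z₂_le
  z₁_lt := h.x₁_lt
  lt_z₂ := h.lt_x₂
  z₂_le := h.x₂_le
  on_x₁ := h.on_z₁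
  on_x₂ := h.on_z₂
  on_z₁ := h.on_x₁
  on_z₂ := h.on_x₂
  off_x := h.off_z
  off_z := h.off_x

lemma rev (h : IsCrossing G ℓ k p q r a b x₁ x₂ z₁ z₂) :
    IsCrossing G ℓ k (fun t => p (ℓ - t)) q r (ℓ - a) b (ℓ - x₂) (ℓ - x₁) z₁ z₂ := by
  have h₁ := h.x₁_lt
  have h₂ := h.lt_x₂
  have h₃ := h.x₂_le
  exact {
    toSpreadTriple := h.toSpreadTriple.rev
    cross := by simpa [Nat.sub_sub_self (show a ≤ ℓ by omega)] using h.cross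
    x₁_lt := by omega
    lt_x₂ := by omega
    x₂_le := by omega
    z₁_lt := h.z₁_lt
    lt_z₂ := h.lt_z₂
    z₂_le := h.z₂_le
    on_x₁ := by simpa [Nat.sub_sub_self h₃] using h.on_x₂
    on_x₂ := by simpa [Nat.sub_sub_self (show x₁ ≤ ℓ by omega)] using h.on_x₁
    on_z₁ := h.on_z₁
    on_z₂ := h.on_z₂
    off_x := fun t ht ht' => h.off_x _ (by omega) (by omega)
    off_z := h.off_z }

lemma mem_core_swap {v : V} (hv : v ∈ crossCore q p z₁ z₂ x₁ x₂) :
    v ∈ crossCore p q x₁ x₂ z₁ z₂ := Or.symm hv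

lemma mem_core_rev (h : x₂ ≤ ℓ) {v : V}
    (hv : v ∈ crossCore (fun t => p (ℓ - t)) q (ℓ - x₂) (ℓ - x₁) z₁ z₂) :
    v ∈ crossCore p q x₁ x₂ z₁ z₂ := by
  rcases hv with ⟨t, ht, rfl⟩ | hv
  · exact Or.inl ⟨ℓ - t, by omega, rfl⟩
  · exact Or.inr hv

lemma not_onSeq_core (h : IsCrossing G ℓ k p q r a b x₁ x₂ z₁ z₂) :
    ∀ v ∈ crossCore p q x₁ x₂ z₁ z₂, ¬ OnSeq ℓ r v := by
  rintro _ (⟨t, ht, rfl⟩ | ⟨t, ht, rfl⟩)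
  exacts [h.off_x t ht.1 ht.2, h.off_z t ht.1 ht.2]

lemma onSeq_cross (h : IsCrossing G ℓ k p q r a b x₁ x₂ z₁ z₂) : OnSeq ℓ q (p a) := by
  have := h.lt_z₂
  have := h.z₂_le
  exact ⟨b, by omega, h.cross.symm⟩

lemma gap_x (h : IsCrossing G ℓ k p q r a b x₁ x₂ z₁ z₂) : x₁ + k ≤ a ∧ a + k ≤ x₂ := by
  have h₁ := h.x₁_lt
  have h₂ := h.lt_x₂
  have h₃ := h.x₂_le
  have := h.gap_fst a (by omega) x₁ (by omega) h.onSeq_cross h.on_x₁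
  have := h.gap_fst a (by omega) x₂ (by omega) h.onSeq_cross h.on_x₂
  omega

lemma bridge_x₁_x₂ (h : IsCrossing G ℓ k p q r a b x₁ x₂ z₁ z₂) :
    Bridge G (crossCore p q x₁ x₂ z₁ z₂) (x₂ - x₁ - 1) (p x₁) (p x₂) := by
  have h₁ := h.x₁_lt
  have h₂ := h.lt_x₂
  have h₃ := h.x₂_le
  refine ⟨p (x₂ - 1), (h.fst.seg_of_le (show x₁ ≤ x₂ - 1 by omega) (by omega)).mono (by omega) ?_,
    ?_⟩
  · rintro _ ⟨t, ⟨h₄, h₅⟩, rfl⟩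
    rcases h₄.eq_or_lt with rfl | h₄
    · exact Or.inl rfl
    · exact Or.inr (Or.inl ⟨t, ⟨h₄, by omega⟩, rfl⟩)
  · have := h.fst.adj (x₂ - 1) (by omega)
    rwa [show x₂ - 1 + 1 = x₂ by omega] at this

/-- From `p x₁`, follow `p` to the first vertex of `q` and then `q` in either direction. -/
lemma bridge_x₁_z (h : IsCrossing G ℓ k p q r a b x₁ x₂ z₁ z₂) :
    ∃ s t, x₁ + k ≤ s ∧ s + k ≤ x₂ ∧ z₁ + k ≤ t ∧ t + k ≤ z₂ ∧
      Bridge G (crossCore p q x₁ x₂ z₁ z₂) ((s - x₁) + (t - z₁ - 1)) (p x₁) (q z₁) ∧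
      Bridge G (crossCore p q x₁ x₂ z₁ z₂) ((s - x₁) + (z₂ - t - 1)) (p x₁) (q z₂) := by
  have h₁ := h.x₁_lt
  have h₂ := h.lt_x₂
  have h₃ := h.x₂_le
  have h₄ := h.z₁_lt
  have h₅ := h.lt_z₂
  have h₆ := h.z₂_le
  have hk := h.pos
  obtain ⟨s, hs, hsa, ⟨t, ht₁, ht₂, hst⟩, hmin⟩ :=
    exists_first_gt (A := fun s => ∃ t, z₁ < t ∧ t < z₂ ∧ p s = q t) h₁ ⟨b, h₄, h₅, h.cross⟩
  have hsq : OnSeq ℓ q (p s) := ⟨t, by omega, hst.symm⟩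
  have htp : OnSeq ℓ p (q t) := ⟨s, by omega, hst⟩
  have g₁ := h.gap_fst s (by omega) x₁ (by omega) hsq h.on_x₁
  have g₂ := h.gap_fst s (by omega) x₂ (by omega) hsq h.on_x₂
  have g₃ := h.gap_snd t (by omega) z₁ (by omega) htp h.on_z₁
  have g₄ := h.gap_snd t (by omega) z₂ (by omega) htp h.on_z₂
  have key : ∀ e, z₁ < e → e < z₂ →
      PathWithin G (p x₁) (q e) ((s - x₁) + ((t - e) + (e - t)))
        (insert (p x₁) (crossCore p q x₁ x₂ z₁ z₂)) := by
    intro e he he'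
    have hq := h.snd.seg (show t ≤ ℓ by omega) (show e ≤ ℓ by omega)
    rw [← hst] at hq
    refine ((h.fst.seg_of_le hs.le (by omega)).glue hq ?_).mono le_rfl ?_
    · rintro _ ⟨s', ⟨hs₁, hs₂⟩, rfl⟩ ⟨t', ht', heq⟩
      rcases hs₁.eq_or_lt with rfl | hs₁
      · exact (h.not_on_all ⟨x₁, by omega, rfl⟩ ⟨t', by omega, heq⟩ h.on_x₁).elim
      rcases hs₂.eq_or_lt with rfl | hs₂
      · rfl
      · exact (hmin s' hs₁ hs₂ ⟨t', by omega, by omega, heq.symm⟩).elim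
    · rintro _ (⟨s', ⟨hs₁, hs₂⟩, rfl⟩ | ⟨t', ht', rfl⟩)
      · rcases hs₁.eq_or_lt with rfl | hs₁
        · exact Or.inl rfl
        · exact Or.inr (Or.inl ⟨s', ⟨hs₁, by omega⟩, rfl⟩)
      · exact Or.inr (Or.inr ⟨t', by omega, rfl⟩)
  refine ⟨s, t, by omega, by omega, by omega, by omega,
    ⟨q (z₁ + 1), (key (z₁ + 1) (by omega) (by omega)).mono (by omega) fun _ h => h,
      (h.snd.adj z₁ (by omega)).symm⟩,
    ⟨q (z₂ - 1), (key (z₂ - 1) (by omega) (by omega)).mono (by omega) fun _ h => h, ?_⟩⟩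
  have := h.snd.adj (z₂ - 1) (by omega)
  rwa [show z₂ - 1 + 1 = z₂ by omega] at this

/-- `r i` is one of the four vertices of `r` nearest to the crossing. -/
def Attach (p q r : ℕ → V) (x₁ x₂ z₁ z₂ i : ℕ) : Prop :=
  r i = p x₁ ∨ r i = p x₂ ∨ r i = q z₁ ∨ r i = q z₂

lemma bridges_x₁ (h : IsCrossing G ℓ k p q r a b x₁ x₂ z₁ z₂) {v : V}
    (hv : v = p x₂ ∨ v = q z₁ ∨ v = q z₂) :
    Bridge G (crossCore p q x₁ x₂ z₁ z₂) (2 * k - 1) (p x₁) v := by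
  have hg := h.gap_x
  obtain ⟨s, t, h₁, h₂, h₃, h₄, h₅, h₆⟩ := h.bridge_x₁_z
  rcases hv with rfl | rfl | rfl
  · exact h.bridge_x₁_x₂.mono (by omega) fun _ h => h
  · exact h₅.mono (by omega) fun _ h => h
  · exact h₆.mono (by omega) fun _ h => h

lemma bridges_x₂ (h : IsCrossing G ℓ k p q r a b x₁ x₂ z₁ z₂) {v : V}
    (hv : v = p x₁ ∨ v = q z₁ ∨ v = q z₂) :
    Bridge G (crossCore p q x₁ x₂ z₁ z₂) (2 * k - 1) (p x₂) v := by
  have h₁ := h.x₁_lt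
  have h₂ := h.lt_x₂
  have h₃ := h.x₂_le
  have := h.rev.bridges_x₁ (v := v)
    (by simpa [Nat.sub_sub_self (show x₁ ≤ ℓ by omega)] using hv)
  simp only [Nat.sub_sub_self h₃] at this
  exact this.mono le_rfl fun _ => mem_core_rev h₃

lemma bridges (h : IsCrossing G ℓ k p q r a b x₁ x₂ z₁ z₂) {i j : ℕ} (hij : r i ≠ r j)
    (hi : Attach p q r x₁ x₂ z₁ z₂ i) (hj : Attach p q r x₁ x₂ z₁ z₂ j) :
    Bridge G (crossCore p q x₁ x₂ z₁ z₂) (2 * k - 1) (r i) (r j) := by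
  rcases hi with hi | hi | hi | hi
  · rw [hi] at hij ⊢
    exact h.bridges_x₁ (hj.resolve_left hij.symm)
  · rw [hi] at hij ⊢
    refine h.bridges_x₂ ?_
    rcases hj with hj | hj | hj | hj
    exacts [Or.inl hj, (hij hj.symm).elim, Or.inr (Or.inl hj), Or.inr (Or.inr hj)]
  · rw [hi] at hij ⊢
    refine (h.swap.bridges_x₁ ?_).mono le_rfl fun _ => mem_core_swap
    rcases hj with hj | hj | hj | hj
    exacts [Or.inr (Or.inl hj), Or.inr (Or.inr hj), (hij hj.symm).elim, Or.inl hj]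
  · rw [hi] at hij ⊢
    refine (h.swap.bridges_x₂ ?_).mono le_rfl fun _ => mem_core_swap
    rcases hj with hj | hj | hj | hj
    exacts [Or.inr (Or.inl hj), Or.inr (Or.inr hj), Or.inl hj, (hij hj.symm).elim]

/-- The four attachment vertices occupy distinct positions on `r`. -/
lemma exists_positions (h : IsCrossing G ℓ k p q r a b x₁ x₂ z₁ z₂) :
    ∃ X₁ X₂ Z₁ Z₂, (X₁ ≤ ℓ ∧ X₂ ≤ ℓ ∧ Z₁ ≤ ℓ ∧ Z₂ ≤ ℓ) ∧
      (r X₁ = p x₁ ∧ r X₂ = p x₂ ∧ r Z₁ = q z₁ ∧ r Z₂ = q z₂) ∧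
      X₁ ≠ X₂ ∧ X₁ ≠ Z₁ ∧ X₁ ≠ Z₂ ∧ X₂ ≠ Z₁ ∧ X₂ ≠ Z₂ ∧ Z₁ ≠ Z₂ := by
  have h₁ := h.x₁_lt
  have h₂ := h.lt_x₂
  have h₃ := h.x₂_le
  have h₄ := h.z₁_lt
  have h₅ := h.lt_z₂
  have h₆ := h.z₂_le
  obtain ⟨X₁, hX₁, e₁⟩ := h.on_x₁
  obtain ⟨X₂, hX₂, e₂⟩ := h.on_x₂
  obtain ⟨Z₁, hZ₁, e₃⟩ := h.on_z₁
  obtain ⟨Z₂, hZ₂, e₄⟩ := h.on_z₂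
  have aux : ∀ X x z, X ≤ ℓ → x ≤ ℓ → z ≤ ℓ → r X = p x → r X = q z → False :=
    fun X x z hX hx hz e e' => h.not_on_all ⟨x, hx, e.symm⟩ ⟨z, hz, e'.symm⟩ ⟨X, hX, rfl⟩
  refine ⟨X₁, X₂, Z₁, Z₂, ⟨hX₁, hX₂, hZ₁, hZ₂⟩, ⟨e₁, e₂, e₃, e₄⟩, ?_, ?_, ?_, ?_, ?_, ?_⟩
  · rintro rfl
    have := h.fst.inj _ (by omega) _ (by omega) (e₁.symm.trans e₂)
    omega
  · rintro rfl
    exact aux _ _ _ hX₁ (by omega) (by omega) e₁ e₃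
  · rintro rfl
    exact aux _ _ _ hX₁ (by omega) (by omega) e₁ e₄
  · rintro rfl
    exact aux _ _ _ hX₂ (by omega) (by omega) e₂ e₃
  · rintro rfl
    exact aux _ _ _ hX₂ (by omega) (by omega) e₂ e₄
  · rintro rfl
    have := h.snd.inj _ (by omega) _ (by omega) (e₃.symm.trans e₄)
    omega

lemma attach_ear (h : IsCrossing G ℓ k p q r a b x₁ x₂ z₁ z₂) {i j : ℕ} (hi : i ≤ ℓ) (hj : j ≤ ℓ)
    (hij : i ≠ j) (hi' : Attach p q r x₁ x₂ z₁ z₂ i) (hj' : Attach p q r x₁ x₂ z₁ z₂ j) :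
    2 * k - 1 ≤ i ∧ 2 * k - 1 + i ≤ ℓ ∧ 2 * k ≤ (i - j) + (j - i) := by
  have hb := h.bridges (fun e => hij (h.trd.inj _ hi _ hj e)) hi' hj'
  have h₁ := hb.half_ear h.trd h.not_onSeq_core hi
  have h₂ := hb.ear h.trd h.not_onSeq_core hi hj hij
  have := h.pos
  omega

/-- If `p` has more than `2 * k` edges between its attachments, then long bridges start at all
four attachments. -/
lemma long_bridges (h : IsCrossing G ℓ k p q r a b x₁ x₂ z₁ z₂) (hx : x₁ + 2 * k < x₂) {i : ℕ}
    (hi : Attach p q r x₁ x₂ z₁ z₂ i) :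
    ∃ v, Bridge G (crossCore p q x₁ x₂ z₁ z₂) (2 * k) (r i) v := by
  have hb : ∀ {z₁ z₂}, IsCrossing G ℓ k p q r a b x₁ x₂ z₁ z₂ → ∃ v,
      Bridge G (crossCore p q x₁ x₂ z₁ z₂) (2 * k) (q z₁) v := by
    intro z₁ z₂ h
    obtain ⟨s, t, h₁, h₂, h₃, h₄, h₅, h₆⟩ := h.swap.bridge_x₁_z
    rcases Nat.lt_or_ge (x₁ + k) t with h' | h'
    · exact ⟨_, h₅.mono (by omega) fun _ => mem_core_swap⟩
    · exact ⟨_, h₆.mono (by omega) fun _ => mem_core_swap⟩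
  have h₁ := h.x₁_lt
  have h₂ := h.lt_x₂
  have h₃ := h.x₂_le
  rcases hi with hi | hi | hi | hi <;> rw [hi]
  · exact ⟨_, h.bridge_x₁_x₂.mono (by omega) fun _ h => h⟩
  · have := h.rev.bridge_x₁_x₂
    simp only [Nat.sub_sub_self h₃] at this
    exact ⟨_, this.mono (by omega) fun _ => mem_core_rev h₃⟩
  · exact hb h
  · obtain ⟨s, t, h₁, h₂, h₃, h₄, h₅, h₆⟩ := h.swap.rev.bridge_x₁_z
    simp only [Nat.sub_sub_self h.z₂_le] at h₅ h₆
    rcases Nat.lt_or_ge (x₁ + k) t with h' | h'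
    · exact ⟨_, h₅.mono (by omega) fun _ hv => mem_core_swap (mem_core_rev h.z₂_le hv)⟩
    · exact ⟨_, h₆.mono (by omega) fun _ hv => mem_core_swap (mem_core_rev h.z₂_le hv)⟩

lemma le_length (h : IsCrossing G ℓ k p q r a b x₁ x₂ z₁ z₂) : 10 * k ≤ ℓ + 2 := by
  obtain ⟨X₁, X₂, Z₁, Z₂, ⟨l₁, l₂, l₃, l₄⟩, ⟨e₁, e₂, e₃, e₄⟩, n₁, n₂, n₃, n₄, n₅, n₆⟩ :=
    h.exists_positions
  have A₁ : Attach p q r x₁ x₂ z₁ z₂ X₁ := Or.inl e₁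
  have A₂ : Attach p q r x₁ x₂ z₁ z₂ X₂ := Or.inr (Or.inl e₂)
  have A₃ : Attach p q r x₁ x₂ z₁ z₂ Z₁ := Or.inr (Or.inr (Or.inl e₃))
  have A₄ : Attach p q r x₁ x₂ z₁ z₂ Z₂ := Or.inr (Or.inr (Or.inr e₄))
  have := h.attach_ear l₁ l₂ n₁ A₁ A₂
  have := h.attach_ear l₁ l₃ n₂ A₁ A₃
  have := h.attach_ear l₁ l₄ n₃ A₁ A₄
  have := h.attach_ear l₂ l₃ n₄ A₂ A₃
  have := h.attach_ear l₂ l₄ n₅ A₂ A₄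
  have := h.attach_ear l₃ l₄ n₆ A₃ A₄
  have := h.attach_ear l₄ l₃ n₆.symm A₄ A₃
  omega

lemma le_length_of_long (h : IsCrossing G ℓ k p q r a b x₁ x₂ z₁ z₂) (hx : x₁ + 2 * k < x₂) :
    10 * k ≤ ℓ := by
  obtain ⟨X₁, X₂, Z₁, Z₂, ⟨l₁, l₂, l₃, l₄⟩, ⟨e₁, e₂, e₃, e₄⟩, n₁, n₂, n₃, n₄, n₅, n₆⟩ :=
    h.exists_positions
  have A₁ : Attach p q r x₁ x₂ z₁ z₂ X₁ := Or.inl e₁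
  have A₂ : Attach p q r x₁ x₂ z₁ z₂ X₂ := Or.inr (Or.inl e₂)
  have A₃ : Attach p q r x₁ x₂ z₁ z₂ Z₁ := Or.inr (Or.inr (Or.inl e₃))
  have A₄ : Attach p q r x₁ x₂ z₁ z₂ Z₂ := Or.inr (Or.inr (Or.inr e₄))
  have key : ∀ i ≤ ℓ, Attach p q r x₁ x₂ z₁ z₂ i → 2 * k ≤ i ∧ 2 * k + i ≤ ℓ := by
    intro i hi hA
    obtain ⟨v, hv⟩ := h.long_bridges hx hA
    exact hv.half_ear h.trd h.not_onSeq_core hi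
  have := h.attach_ear l₁ l₂ n₁ A₁ A₂
  have := h.attach_ear l₁ l₃ n₂ A₁ A₃
  have := h.attach_ear l₁ l₄ n₃ A₁ A₄
  have := h.attach_ear l₂ l₃ n₄ A₂ A₃
  have := h.attach_ear l₂ l₄ n₅ A₂ A₄
  have := h.attach_ear l₃ l₄ n₆ A₃ A₄
  have := key _ l₁ A₁
  have := key _ l₂ A₂
  have := key _ l₃ A₃
  have := key _ l₄ A₄
  omega

end IsCrossing

namespace SpreadTriple

variable {V : Type*} {G : SimpleGraph V} {ℓ k : ℕ} {p q r : ℕ → V}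

/-- `I` consists of indices of vertices of `p` that lie on neither `q` nor `r`. -/
def FreeIndices (ℓ : ℕ) (p q r : ℕ → V) (I : Finset ℕ) : Prop :=
  ∀ i ∈ I, i ≤ ℓ ∧ ¬ OnSeq ℓ q (p i) ∧ ¬ OnSeq ℓ r (p i)

lemma exists_free_between (h : SpreadTriple G ℓ k p q r) {s t : ℕ} (hst : s < t) (ht : t ≤ ℓ)
    (hon : (OnSeq ℓ q (p s) ∧ OnSeq ℓ r (p t)) ∨ (OnSeq ℓ r (p s) ∧ OnSeq ℓ q (p t))) :
    ∃ I, FreeIndices ℓ p q r I ∧ k - 1 ≤ I.card ∧ ∀ i ∈ I, s < i ∧ i < t := by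
  rcases hon with ⟨h₁, h₂⟩ | ⟨h₁, h₂⟩
  · obtain ⟨s', t', hs, hst', ht', hA, hB, hno⟩ := exists_consecutive
      (A := fun i => OnSeq ℓ q (p i)) (B := fun i => OnSeq ℓ r (p i)) hst h₁ h₂
    have := h.gap_fst s' (by omega) t' (by omega) hA hB
    refine ⟨Finset.Ioo s' t', fun i hi => ?_, by rw [Nat.card_Ioo]; omega, fun i hi => ?_⟩
    · rw [Finset.mem_Ioo] at hi
      exact ⟨by omega, hno i hi.1 hi.2⟩
    · rw [Finset.mem_Ioo] at hi
      omega
  · obtain ⟨s', t', hs, hst', ht', hA, hB, hno⟩ := exists_consecutive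
      (A := fun i => OnSeq ℓ r (p i)) (B := fun i => OnSeq ℓ q (p i)) hst h₁ h₂
    have := h.gap_fst t' (by omega) s' (by omega) hB hA
    refine ⟨Finset.Ioo s' t', fun i hi => ?_, by rw [Nat.card_Ioo]; omega, fun i hi => ?_⟩
    · rw [Finset.mem_Ioo] at hi
      exact ⟨by omega, (hno i hi.1 hi.2).symm⟩
    · rw [Finset.mem_Ioo] at hi
      omega

lemma FreeIndices.union {I J : Finset ℕ} (hI : FreeIndices ℓ p q r I)
    (hJ : FreeIndices ℓ p q r J) : FreeIndices ℓ p q r (I ∪ J) := fun i hi =>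
  (Finset.mem_union.1 hi).elim (hI i) (hJ i)

lemma exists_free (h : SpreadTriple G ℓ k p q r) :
    ∃ I, FreeIndices ℓ p q r I ∧ k - 1 ≤ I.card := by
  obtain ⟨s, hs, s', hs', es⟩ := h.meet_fst_snd
  obtain ⟨t, ht, t', ht', et⟩ := h.meet_fst_trd
  have h₁ : OnSeq ℓ q (p s) := ⟨s', hs', es.symm⟩
  have h₂ : OnSeq ℓ r (p t) := ⟨t', ht', et.symm⟩
  rcases lt_trichotomy s t with hst | rfl | hst
  · obtain ⟨I, hI, hc, -⟩ := h.exists_free_between hst ht (Or.inl ⟨h₁, h₂⟩)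
    exact ⟨I, hI, hc⟩
  · exact (h.not_on_all ⟨s, hs, rfl⟩ h₁ h₂).elim
  · obtain ⟨I, hI, hc, -⟩ := h.exists_free_between hst hs (Or.inr ⟨h₂, h₁⟩)
    exact ⟨I, hI, hc⟩

lemma sum_indicator_le {P Q R P' Q' R' : Prop} [Decidable P] [Decidable Q] [Decidable R]
    [Decidable P'] [Decidable Q'] [Decidable R'] (h : ¬ (P ∧ Q ∧ R)) (hP : P' → P ∧ ¬ Q ∧ ¬ R)
    (hQ : Q' → Q ∧ ¬ P ∧ ¬ R) (hR : R' → R ∧ ¬ P ∧ ¬ Q) :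
    (if P then 1 else 0) + (if Q then 1 else 0) + (if R then 1 else 0) + (if P' then 1 else 0)
      + (if Q' then 1 else 0) + (if R' then 1 else 0) ≤ 2 := by
  by_cases h₁ : P <;> by_cases h₂ : Q <;> by_cases h₃ : R <;> simp_all <;> split_ifs <;> omega

/-- No vertex lies on all three paths, so the vertices on one path only can be counted twice. -/
lemma length_add_card_free_le [Fintype V] (h : SpreadTriple G ℓ k p q r) {I J K : Finset ℕ}
    (hI : FreeIndices ℓ p q r I) (hJ : FreeIndices ℓ q p r J) (hK : FreeIndices ℓ r p q K) :
    3 * (ℓ + 1) + I.card + J.card + K.card ≤ 2 * Fintype.card V := by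
  classical
  have card_img : ∀ {p q r : ℕ → V} {I : Finset ℕ}, IsLongestSeq G ℓ p → FreeIndices ℓ p q r I →
      (I.image p).card = I.card := fun hp hI => Finset.card_image_of_injOn
    fun s hs t ht e => hp.inj s (hI s hs).1 t (hI t ht).1 e
  have card_range : ∀ {p : ℕ → V}, IsLongestSeq G ℓ p →
      ((Finset.range (ℓ + 1)).image p).card = ℓ + 1 := fun hp => by
    rw [Finset.card_image_of_injOn, Finset.card_range]
    intro s hs t ht e
    simp only [Finset.coe_range, Set.mem_Iio] at hs ht
    exact hp.inj s (by omega) t (by omega) e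
  have mem_range : ∀ {p : ℕ → V} {v : V},
      v ∈ (Finset.range (ℓ + 1)).image p ↔ OnSeq ℓ p v := by
    intro p v
    simp [OnSeq]
  have mem_img : ∀ {p q r : ℕ → V} {I : Finset ℕ} {v : V}, FreeIndices ℓ p q r I →
      v ∈ I.image p → OnSeq ℓ p v ∧ ¬ OnSeq ℓ q v ∧ ¬ OnSeq ℓ r v := by
    intro p q r I v hI hv
    obtain ⟨i, hi, rfl⟩ := Finset.mem_image.1 hv
    exact ⟨⟨i, (hI i hi).1, rfl⟩, (hI i hi).2⟩
  have card_eq : ∀ A : Finset V, A.card = ∑ v, if v ∈ A then 1 else 0 := fun A => by simp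
  calc 3 * (ℓ + 1) + I.card + J.card + K.card
      = ∑ v, ((if v ∈ (Finset.range (ℓ + 1)).image p then 1 else 0)
        + (if v ∈ (Finset.range (ℓ + 1)).image q then 1 else 0)
        + (if v ∈ (Finset.range (ℓ + 1)).image r then 1 else 0)
        + (if v ∈ I.image p then 1 else 0) + (if v ∈ J.image q then 1 else 0)
        + (if v ∈ K.image r then 1 else 0)) := by
        simp only [Finset.sum_add_distrib, ← card_eq]
        rw [card_range h.fst, card_range h.snd, card_range h.trd, card_img h.fst hI,
          card_img h.snd hJ, card_img h.trd hK]
        ring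
    _ ≤ ∑ _v : V, 2 := by
        refine Finset.sum_le_sum fun v _ => ?_
        have h₀ : ¬ (OnSeq ℓ p v ∧ OnSeq ℓ q v ∧ OnSeq ℓ r v) := fun hv =>
          h.not_on_all hv.1 hv.2.1 hv.2.2
        have h₁ := @mem_img p q r I v hI
        have h₂ := @mem_img q p r J v hJ
        have h₃ := @mem_img r p q K v hK
        simp only [mem_range]
        exact sum_indicator_le h₀ h₁ h₂ h₃
    _ = 2 * Fintype.card V := by simp [mul_comm]

end SpreadTriple

namespace IsCrossing

open SpreadTriple

variable {V : Type*} {G : SimpleGraph V} {ℓ k a b x₁ x₂ z₁ z₂ : ℕ} {p q r : ℕ → V}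

lemma exists_free_legs (h : IsCrossing G ℓ k p q r a b x₁ x₂ z₁ z₂) :
    ∃ I, FreeIndices ℓ p q r I ∧ 2 * (k - 1) ≤ I.card ∧ ∀ i ∈ I, x₁ < i ∧ i < x₂ := by
  have h₁ := h.x₁_lt
  have h₂ := h.lt_x₂
  have h₃ := h.x₂_le
  obtain ⟨I, hI, cI, bI⟩ := h.exists_free_between h₁ (by omega) (Or.inr ⟨h.on_x₁, h.onSeq_cross⟩)
  obtain ⟨J, hJ, cJ, bJ⟩ := h.exists_free_between h₂ (by omega) (Or.inl ⟨h.onSeq_cross, h.on_x₂⟩)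
  refine ⟨I ∪ J, hI.union hJ, ?_, fun i hi => ?_⟩
  · rw [Finset.card_union_of_disjoint]
    · omega
    · rw [Finset.disjoint_left]
      intro i hi hj
      have := bI i hi
      have := bJ i hj
      omega
  · rcases Finset.mem_union.1 hi with hi | hi
    · have := bI i hi
      omega
    · have := bJ i hi
      omega

/-- A common vertex of `p` and `q` outside the segment `p x₁, …, p x₂` yields more vertices that
lie on `p` only. -/
lemma exists_free_outside (h : IsCrossing G ℓ k p q r a b x₁ x₂ z₁ z₂) {c : ℕ} (hc : c ≤ ℓ)
    (hcq : OnSeq ℓ q (p c)) (hcx : c < x₁ ∨ x₂ < c) :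
    ∃ I, FreeIndices ℓ p q r I ∧ 3 * (k - 1) ≤ I.card := by
  have h₁ := h.x₁_lt
  have h₂ := h.lt_x₂
  have h₃ := h.x₂_le
  obtain ⟨I, hI, cI, bI⟩ := h.exists_free_legs
  have hJ : ∃ J, FreeIndices ℓ p q r J ∧ k - 1 ≤ J.card ∧ ∀ i ∈ J, i < x₁ ∨ x₂ < i := by
    rcases hcx with hcx | hcx
    · obtain ⟨J, hJ, cJ, bJ⟩ := h.exists_free_between hcx (by omega) (Or.inl ⟨hcq, h.on_x₁⟩)
      exact ⟨J, hJ, cJ, fun i hi => Or.inl (bJ i hi).2⟩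
    · obtain ⟨J, hJ, cJ, bJ⟩ := h.exists_free_between hcx hc (Or.inr ⟨h.on_x₂, hcq⟩)
      exact ⟨J, hJ, cJ, fun i hi => Or.inr (bJ i hi).1⟩
  obtain ⟨J, hJ, cJ, bJ⟩ := hJ
  refine ⟨I ∪ J, hI.union hJ, ?_⟩
  rw [Finset.card_union_of_disjoint]
  · omega
  · rw [Finset.disjoint_left]
    intro i hi hj
    have := bI i hi
    have := bJ i hj
    omega

lemma bound_of_long [Fintype V] (h : IsCrossing G ℓ k p q r a b x₁ x₂ z₁ z₂)
    (hx : x₁ + 2 * k < x₂) : 17 * k ≤ Fintype.card V := by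
  obtain ⟨I, hI, cI, -⟩ := h.exists_free_legs
  obtain ⟨J, hJ, cJ, -⟩ := h.swap.exists_free_legs
  obtain ⟨K, hK, cK⟩ := h.swap_snd_trd.swap.exists_free
  have := h.length_add_card_free_le hI hJ hK
  have := h.le_length_of_long hx
  have := h.pos
  omega

/-- If `p` and `q` had only one common vertex, then a piece of `r` connecting them would give an
ear on `p` and an ear on `q`, one of them too long. -/
lemma exists_common (h : SpreadTriple G ℓ k p q r) {a b : ℕ} (ha : a ≤ ℓ) (hb : b ≤ ℓ)
    (hab : p a = q b) : ∃ c ≤ ℓ, c ≠ a ∧ OnSeq ℓ q (p c) := by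
  by_contra! hno
  have hno' : ∀ t, OnSeq ℓ p (q t) → t ≤ ℓ → t = b := by
    rintro t ⟨s, hs, e⟩ ht
    by_cases hsa : s = a
    · subst hsa
      exact h.snd.inj _ ht _ hb (e.symm.trans hab)
    · exact (hno s hs hsa ⟨t, ht, e.symm⟩).elim
  obtain ⟨i, j, hi, hj, hiP, hjQ, hfree⟩ : ∃ i j, i ≤ ℓ ∧ j ≤ ℓ ∧ OnSeq ℓ p (r i) ∧
      OnSeq ℓ q (r j) ∧ ∀ m, ((i < m ∧ m < j) ∨ (j < m ∧ m < i)) →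
        ¬ OnSeq ℓ p (r m) ∧ ¬ OnSeq ℓ q (r m) := by
    obtain ⟨s, hs, s', hs', es⟩ := h.meet_fst_trd
    obtain ⟨t, ht, t', ht', et⟩ := h.meet_snd_trd
    have h₁ : OnSeq ℓ p (r s') := ⟨s, hs, es⟩
    have h₂ : OnSeq ℓ q (r t') := ⟨t, ht, et⟩
    rcases lt_trichotomy s' t' with hst | rfl | hst
    · obtain ⟨i, j, h₃, h₄, h₅, h₆, h₇, h₈⟩ := exists_consecutive
        (A := fun i => OnSeq ℓ p (r i)) (B := fun i => OnSeq ℓ q (r i)) hst h₁ h₂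
      exact ⟨i, j, by omega, by omega, h₆, h₇, fun m hm => h₈ m (by omega) (by omega)⟩
    · exact (h.not_on_all h₁ h₂ ⟨s', hs', rfl⟩).elim
    · obtain ⟨j, i, h₃, h₄, h₅, h₆, h₇, h₈⟩ := exists_consecutive
        (A := fun i => OnSeq ℓ q (r i)) (B := fun i => OnSeq ℓ p (r i)) hst h₂ h₁
      exact ⟨i, j, by omega, by omega, h₇, h₆, fun m hm => (h₈ m (by omega) (by omega)).symm⟩
  have hij : i ≠ j := by
    rintro rfl
    exact h.not_on_all hiP hjQ ⟨i, hi, rfl⟩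
  obtain ⟨s, hs, es⟩ := hiP
  obtain ⟨t, ht, et⟩ := hjQ
  have hbr : ¬ OnSeq ℓ r (q b) := fun hon => h.not_on_all ⟨a, ha, hab⟩ ⟨b, hb, rfl⟩ hon
  have hsa : a ≠ s := by
    rintro rfl
    exact hbr ⟨i, hi, es.symm.trans hab⟩
  have htb : b ≠ t := by
    rintro rfl
    exact hbr ⟨j, hj, et.symm⟩
  have ear₁ : (b - t) + (t - b) + ((j - i) + (i - j)) ≤ (a - s) + (s - a) := by
    have w₁ := h.snd.seg hb ht
    have w₂ := h.trd.seg hj hi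
    rw [← hab, et] at w₁
    rw [← es] at w₂
    refine h.fst.ear ha hs hsa (w₁.glue w₂ ?_) ?_
    · rintro _ ⟨t', ht', rfl⟩ ⟨m, hm, e⟩
      by_cases hmj : m = j
      · rw [← e, hmj]
      by_cases hmi : m = i
      · subst hmi
        exact (h.not_on_all ⟨s, hs, es⟩ ⟨t', by omega, e.symm⟩ ⟨m, hi, rfl⟩).elim
      · exact ((hfree m (by omega)).2 ⟨t', by omega, e.symm⟩).elim
    · rintro _ (⟨t', ht', rfl⟩ | ⟨m, hm, rfl⟩) hon
      · rw [hno' t' hon (by omega)]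
        exact Or.inl hab.symm
      · by_cases hmi : m = i
        · rw [hmi]
          exact Or.inr es.symm
        by_cases hmj : m = j
        · subst hmj
          exact (h.not_on_all hon ⟨t, ht, et⟩ ⟨m, hj, rfl⟩).elim
        · exact ((hfree m (by omega)).1 hon).elim
  have ear₂ : (a - s) + (s - a) + ((i - j) + (j - i)) ≤ (b - t) + (t - b) := by
    have w₁ := h.fst.seg ha hs
    have w₂ := h.trd.seg hi hj
    rw [hab, es] at w₁
    rw [← et] at w₂
    refine h.snd.ear hb ht htb (w₁.glue w₂ ?_) ?_
    · rintro _ ⟨s', hs', rfl⟩ ⟨m, hm, e⟩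
      by_cases hmi : m = i
      · rw [← e, hmi]
      by_cases hmj : m = j
      · subst hmj
        exact (h.not_on_all ⟨s', by omega, e.symm⟩ ⟨t, ht, et⟩ ⟨m, hj, rfl⟩).elim
      · exact ((hfree m (by omega)).1 ⟨s', by omega, e.symm⟩).elim
    · rintro _ (⟨s', hs', rfl⟩ | ⟨m, hm, rfl⟩) hon
      · by_cases hsa : s' = a
        · rw [hsa]
          exact Or.inl hab
        · exact (hno s' (by omega) hsa hon).elim
      · by_cases hmj : m = j
        · rw [hmj]
          exact Or.inr et.symm
        by_cases hmi : m = i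
        · subst hmi
          exact (h.not_on_all ⟨s, hs, es⟩ hon ⟨m, hi, rfl⟩).elim
        · exact ((hfree m (by omega)).2 hon).elim
  omega

end IsCrossing

namespace IsLongestSeq

variable {V : Type*} {G : SimpleGraph V} {ℓ n i e t : ℕ} {r : ℕ → V} {S : Set V} {v c : V}

/-- Follow `r` up to `r i`, a bridge to `r t`, `r` back to `r (i + 1)`, and an edge off `r`. -/
lemma detour_off (hr : IsLongestSeq G ℓ r) (hS : ∀ x ∈ S, ¬ OnSeq ℓ r x) (hit : i < t)
    (ht : t ≤ ℓ) (hb : Bridge G S n (r i) (r t)) (hc : G.Adj (r (i + 1)) c)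
    (hcr : ¬ OnSeq ℓ r c) (hcS : c ∉ S) : n + 1 + t ≤ ℓ := by
  have hne : r i ≠ r t := fun h => by
    have := hr.inj _ (by omega) _ ht h
    omega
  have hb' := hb.path hne fun h => hS _ h ⟨t, ht, rfl⟩
  have w₁ := (hr.seg (Nat.zero_le ℓ) (show i ≤ ℓ by omega)).glue hb' (by
    rintro _ ⟨s, hs, rfl⟩ ((h | h) | h)
    · exact h
    · exact (hS _ h ⟨s, by omega, rfl⟩).elim
    · have := hr.inj _ (by omega) _ ht h
      omega)
  have w₂ := w₁.glue (hr.seg ht (show i + 1 ≤ ℓ by omega)) (by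
    rintro _ (⟨s, hs, rfl⟩ | (rfl | h) | h) ⟨s', hs', e'⟩
    · have := hr.inj _ (by omega) _ (by omega) e'
      omega
    · have := hr.inj _ (by omega) _ (by omega) e'
      omega
    · exact (hS _ h ⟨s', by omega, e'⟩).elim
    · exact h)
  have := hr.long _ _ _ _ (w₂.link hc (.nil c) (by
    rintro _ ((⟨s, hs, rfl⟩ | (rfl | h) | rfl) | ⟨s, hs, rfl⟩) rfl
    · exact hcr ⟨s, by omega, rfl⟩
    · exact hcr ⟨i, by omega, rfl⟩
    · exact hcS h
    · exact hcr ⟨t, by omega, rfl⟩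
    · exact hcr ⟨s, by omega, rfl⟩))
  omega

/-- Follow `r` down to `r (i + 1)`, an edge to `r e`, `r` up to `r i`, and a bridge. -/
lemma detour_half (hr : IsLongestSeq G ℓ r) (hS : ∀ x ∈ S, ¬ OnSeq ℓ r x) (hei : e < i)
    (hi : i + 1 ≤ ℓ) (hb : Bridge G S n (r i) v) (hc : G.Adj (r (i + 1)) (r e)) : n ≤ e := by
  obtain ⟨w, hw, -⟩ := hb
  have w₁ := (hr.seg le_rfl hi).link hc (hr.seg (show e ≤ ℓ by omega) (show i ≤ ℓ by omega)) (by
    rintro _ ⟨s, hs, rfl⟩ ⟨s', hs', e'⟩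
    have := hr.inj _ (by omega) _ (by omega) e'
    omega)
  have := hr.long _ _ _ _ (w₁.glue hw (by
    rintro _ (⟨s, hs, rfl⟩ | ⟨s, hs, rfl⟩) (h | h)
    · exact h
    · exact (hS _ h ⟨s, by omega, rfl⟩).elim
    · exact h
    · exact (hS _ h ⟨s, by omega, rfl⟩).elim))
  omega

/-- Follow `r` down to `r (i + 1)`, an edge to `r e`, `r` up to `r i`, a bridge to `r t`, and `r`
down to its start. -/
lemma detour_below (hr : IsLongestSeq G ℓ r) (hS : ∀ x ∈ S, ¬ OnSeq ℓ r x) (hte : t < e)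
    (hei : e < i) (hi : i + 1 ≤ ℓ) (hb : Bridge G S n (r i) (r t))
    (hc : G.Adj (r (i + 1)) (r e)) : n + 1 + t ≤ e := by
  have hne : r i ≠ r t := fun h => by
    have := hr.inj _ (by omega) _ (by omega) h
    omega
  have hb' := hb.path hne fun h => hS _ h ⟨t, by omega, rfl⟩
  have w₁ := (hr.seg le_rfl hi).link hc (hr.seg (show e ≤ ℓ by omega) (show i ≤ ℓ by omega)) (by
    rintro _ ⟨s, hs, rfl⟩ ⟨s', hs', e'⟩
    have := hr.inj _ (by omega) _ (by omega) e'
    omega)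
  have w₂ := w₁.glue hb' (by
    rintro _ (⟨s, hs, rfl⟩ | ⟨s, hs, rfl⟩) ((h | h) | h)
    · exact h
    · exact (hS _ h ⟨s, by omega, rfl⟩).elim
    · have := hr.inj _ (by omega) _ (by omega) h
      omega
    · exact h
    · exact (hS _ h ⟨s, by omega, rfl⟩).elim
    · have := hr.inj _ (by omega) _ (by omega) h
      omega)
  have := hr.long _ _ _ _ (w₂.glue (hr.seg (show t ≤ ℓ by omega) (Nat.zero_le ℓ)) (by
    rintro _ ((⟨s, hs, rfl⟩ | ⟨s, hs, rfl⟩) | (rfl | h) | h) ⟨s', hs', e'⟩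
    · have := hr.inj _ (by omega) _ (by omega) e'
      omega
    · have := hr.inj _ (by omega) _ (by omega) e'
      omega
    · have := hr.inj _ (by omega) _ (by omega) e'
      omega
    · exact (hS _ h ⟨s', by omega, e'⟩).elim
    · exact h))
  omega

/-- Follow `r` down to `r e`, an edge to `r (i + 1)`, `r` up to `r t`, a bridge to `r i`, and `r`
down to its start. -/
lemma detour_above (hr : IsLongestSeq G ℓ r) (hS : ∀ x ∈ S, ¬ OnSeq ℓ r x) (hit : i < t)
    (hte : t < e) (he : e ≤ ℓ) (hb : Bridge G S n (r t) (r i))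
    (hc : G.Adj (r (i + 1)) (r e)) : n + 1 + t ≤ e := by
  have hne : r t ≠ r i := fun h => by
    have := hr.inj _ (by omega) _ (by omega) h
    omega
  have hb' := hb.path hne fun h => hS _ h ⟨i, by omega, rfl⟩
  have w₁ := (hr.seg le_rfl he).link hc.symm
    (hr.seg (show i + 1 ≤ ℓ by omega) (show t ≤ ℓ by omega)) (by
      rintro _ ⟨s, hs, rfl⟩ ⟨s', hs', e'⟩
      have := hr.inj _ (by omega) _ (by omega) e'
      omega)
  have w₂ := w₁.glue hb' (by
    rintro _ (⟨s, hs, rfl⟩ | ⟨s, hs, rfl⟩) ((h | h) | h)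
    · exact h
    · exact (hS _ h ⟨s, by omega, rfl⟩).elim
    · have := hr.inj _ (by omega) _ (by omega) h
      omega
    · exact h
    · exact (hS _ h ⟨s, by omega, rfl⟩).elim
    · have := hr.inj _ (by omega) _ (by omega) h
      omega)
  have := hr.long _ _ _ _ (w₂.glue (hr.seg (show i ≤ ℓ by omega) (Nat.zero_le ℓ)) (by
    rintro _ ((⟨s, hs, rfl⟩ | ⟨s, hs, rfl⟩) | (rfl | h) | h) ⟨s', hs', e'⟩
    · have := hr.inj _ (by omega) _ (by omega) e'
      omega
    · have := hr.inj _ (by omega) _ (by omega) e'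
      omega
    · have := hr.inj _ (by omega) _ (by omega) e'
      omega
    · exact (hS _ h ⟨s', by omega, e'⟩).elim
    · exact h))
  omega

/-- If long bridges join the vertices `r i` with `A i`, then the neighbours of `r (i + 1)` outside
the bridges are among these vertices or on the segment from `r i` to `r j`. -/
lemma neighbor_mem (hr : IsLongestSeq G ℓ r) (hS : ∀ x ∈ S, ¬ OnSeq ℓ r x) {A : ℕ → Prop} {j : ℕ}
    (hA : ∀ i, A i → i ≤ ℓ)
    (hb : ∀ i j, A i → A j → i ≠ j → Bridge G S n (r i) (r j)) (hi : A i) (hj : A j)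
    (hij : i < j) (hend : ∃ t, A t ∧ i < t ∧ ℓ < n + 1 + t)
    (hcov : ∀ e ≤ ℓ, ¬ A e → (e < i ∨ j < e) → (e < i ∧ e < n) ∨
      (∃ t, A t ∧ t < e ∧ e < i ∧ e < n + 1 + t) ∨ ∃ t, A t ∧ i < t ∧ t < e ∧ e < n + 1 + t)
    (hc : G.Adj (r (i + 1)) c) (hcS : c ∉ S) :
    ∃ e ≤ ℓ, r e = c ∧ (A e ∨ (i ≤ e ∧ e ≤ j)) := by
  have hjl := hA j hj
  by_cases hcr : OnSeq ℓ r c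
  · obtain ⟨e, he, rfl⟩ := hcr
    refine ⟨e, he, rfl, ?_⟩
    by_contra! hno
    rcases hcov e he hno.1 (by omega) with ⟨h₁, h₂⟩ | ⟨t, h₁, h₂, h₃, h₄⟩ | ⟨t, h₁, h₂, h₃, h₄⟩
    · have := hr.detour_half hS h₁ (by omega) (hb i j hi hj hij.ne) hc
      omega
    · have := hr.detour_below hS h₂ h₃ (by omega) (hb i t hi h₁ (by omega)) hc
      omega
    · have := hr.detour_above hS h₂ h₃ he (hb t i h₁ hi (by omega)) hc
      omega
  · obtain ⟨t, h₁, h₂, h₃⟩ := hend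
    have := hr.detour_off hS h₂ (hA t h₁) (hb i t hi h₁ (by omega)) hc hcr hcS
    omega

end IsLongestSeq

namespace IsCrossing

variable {V : Type*} {G : SimpleGraph V} {ℓ k a b x₁ x₂ z₁ z₂ : ℕ} {p q r : ℕ → V}

lemma common_outside (h : IsCrossing G ℓ k p q r a b x₁ x₂ z₁ z₂) (hx : x₂ ≤ x₁ + 2 * k) {c : ℕ}
    (hc : c ≤ ℓ) (hca : c ≠ a) (hcq : OnSeq ℓ q (p c)) : c < x₁ ∨ x₂ < c := by
  have h₁ := h.x₁_lt
  have h₂ := h.lt_x₂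
  have h₃ := h.x₂_le
  have := h.gap_x
  have := h.gap_fst c hc x₁ (by omega) hcq h.on_x₁
  have := h.gap_fst c hc x₂ (by omega) hcq h.on_x₂
  have := h.pos
  omega

lemma bound_of_short [Fintype V] (h : IsCrossing G ℓ k p q r a b x₁ x₂ z₁ z₂)
    (hx : x₂ ≤ x₁ + 2 * k) (hz : z₂ ≤ z₁ + 2 * k) :
    17 * k ≤ Fintype.card V ∨ (k = 1 ∧ ℓ ≤ 9) ∨ (k = 2 ∧ ℓ = 18) := by
  have h₂ := h.lt_x₂
  have h₃ := h.x₂_le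
  have h₄ := h.lt_z₂
  have h₅ := h.z₂_le
  obtain ⟨c, hc, hca, d, hd, hdc⟩ := exists_common h.toSpreadTriple (by omega) (by omega) h.cross
  have hdb : d ≠ b := by
    rintro rfl
    exact hca (h.fst.inj _ hc _ (by omega) (hdc.symm.trans h.cross.symm))
  obtain ⟨I, hI, cI⟩ := h.exists_free_outside hc ⟨d, hd, hdc⟩
    (h.common_outside hx hc hca ⟨d, hd, hdc⟩)
  obtain ⟨J, hJ, cJ⟩ := h.swap.exists_free_outside hd ⟨c, hc, hdc.symm⟩
    (h.swap.common_outside hz hd hdb ⟨c, hc, hdc.symm⟩)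
  obtain ⟨K, hK, cK⟩ := h.swap_snd_trd.swap.exists_free
  have := h.length_add_card_free_le hI hJ hK
  have := h.le_length
  have := h.pos
  omega

/-- From the crossing along `q` to an attachment on `r`, then along `r` to the nearest vertex
of `p`. -/
lemma leg_ear (h : IsCrossing G ℓ k p q r a b x₁ x₂ z₁ z₂) (hz : z₂ ≤ z₁ + 2 * k) {j e m : ℕ}
    (hj : j ≤ ℓ) (hjz : r j = q z₁ ∨ r j = q z₂) (he : e ≤ ℓ) (hm : m ≤ ℓ) (hem : r e = p m)
    (hno : ∀ s, ((e < s ∧ s < j) ∨ (j < s ∧ s < e)) → ¬ OnSeq ℓ p (r s)) :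
    k + ((j - e) + (e - j)) ≤ (a - m) + (m - a) := by
  have h₁ := h.z₁_lt
  have h₂ := h.lt_z₂
  have h₃ := h.z₂_le
  have h₄ := h.lt_x₂
  have h₅ := h.x₂_le
  have hg := h.swap.gap_x
  obtain ⟨z, hzl, hjz, hzr, hzd⟩ : ∃ z ≤ ℓ, r j = q z ∧ OnSeq ℓ r (q z) ∧
      (z = z₁ ∨ z = z₂) := by
    rcases hjz with hjz | hjz
    exacts [⟨z₁, by omega, hjz, h.on_z₁, Or.inl rfl⟩, ⟨z₂, by omega, hjz, h.on_z₂, Or.inr rfl⟩]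
  have ham : a ≠ m := by
    rintro rfl
    exact h.not_on_all ⟨a, hm, rfl⟩ h.onSeq_cross ⟨e, he, hem⟩
  have hleg : ∀ t, ((b ≤ t ∧ t ≤ z) ∨ (z ≤ t ∧ t ≤ b)) → OnSeq ℓ p (q t) → t = b := by
    intro t ht hon
    have := h.gap_snd t (by omega) z hzl hon hzr
    omega
  have w₁ := h.snd.seg (show b ≤ ℓ by omega) hzl
  rw [← h.cross, ← hjz] at w₁
  have w₂ := h.trd.seg hj he
  rw [hem] at w₂
  have := h.fst.ear (by omega) hm ham (w₁.glue w₂ ?_) ?_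
  · omega
  · rintro _ ⟨t, ht, rfl⟩ ⟨s, hs, hst⟩
    by_cases htz : t = z
    · rw [htz, hjz]
    · by_cases htb : t = b
      · subst htb
        exact (h.not_on_all ⟨a, by omega, h.cross⟩ ⟨t, by omega, rfl⟩ ⟨s, by omega, hst⟩).elim
      · exact (h.off_z t (by omega) (by omega) ⟨s, by omega, hst⟩).elim
  · rintro _ (⟨t, ht, rfl⟩ | ⟨s, hs, rfl⟩) hon
    · rw [hleg t ht hon]
      exact Or.inl h.cross.symm
    · by_cases hse : s = e
      · rw [hse]
        exact Or.inr hem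
      · by_cases hsj : s = j
        · subst hsj
          exact (h.not_on_all hon ⟨z, hzl, hjz.symm⟩ ⟨s, hj, rfl⟩).elim
        · exact (hno s (by omega) hon).elim

lemma dist_attach (h : IsCrossing G ℓ k p q r a b x₁ x₂ z₁ z₂) (hx : x₂ ≤ x₁ + 2 * k) {i m : ℕ}
    (hi : r i = p x₁ ∨ r i = p x₂) (hm : m ≤ ℓ) (him : r i = p m) :
    (a - m) + (m - a) = k := by
  have h₁ := h.x₁_lt
  have h₂ := h.lt_x₂
  have h₃ := h.x₂_le
  have hg := h.gap_x
  rcases hi with hi | hi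
  · have := h.fst.inj _ hm _ (by omega) (him.symm.trans hi)
    omega
  · have := h.fst.inj _ hm _ (by omega) (him.symm.trans hi)
    omega

lemma onSeq_x (h : IsCrossing G ℓ k p q r a b x₁ x₂ z₁ z₂) {i : ℕ}
    (hi : r i = p x₁ ∨ r i = p x₂) : OnSeq ℓ p (r i) := by
  have h₁ := h.x₁_lt
  have h₂ := h.lt_x₂
  have h₃ := h.x₂_le
  rcases hi with hi | hi
  exacts [⟨x₁, by omega, hi.symm⟩, ⟨x₂, h₃, hi.symm⟩]

/-- The last vertex of `p` on `r` before an attachment of `q` is not an attachment of `p`. -/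
lemma exists_last_fst (h : IsCrossing G ℓ k p q r a b x₁ x₂ z₁ z₂) (hx : x₂ ≤ x₁ + 2 * k)
    (hz : z₂ ≤ z₁ + 2 * k) {i j : ℕ} (hij : i < j) (hj : j ≤ ℓ) (hi : r i = p x₁ ∨ r i = p x₂)
    (hjz : r j = q z₁ ∨ r j = q z₂) :
    ∃ e, i < e ∧ e < j ∧ OnSeq ℓ p (r e) ∧ ∀ s, e < s → s < j → ¬ OnSeq ℓ p (r s) := by
  obtain ⟨e, hie, hej, hon, hno⟩ := exists_last_lt (A := fun s => OnSeq ℓ p (r s)) hij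
    (h.onSeq_x hi)
  refine ⟨e, lt_of_le_of_ne hie ?_, hej, hon, hno⟩
  rintro rfl
  obtain ⟨m, hm, hem⟩ := hon
  have := h.leg_ear hz hj hjz (by omega) hm hem.symm (fun s hs => hno s (by omega) (by omega))
  have := h.dist_attach hx hi hm hem.symm
  omega

lemma exists_first_snd (h : IsCrossing G ℓ k p q r a b x₁ x₂ z₁ z₂) (hx : x₂ ≤ x₁ + 2 * k)
    (hz : z₂ ≤ z₁ + 2 * k) {i j : ℕ} (hij : i < j) (hj : j ≤ ℓ) (hi : r i = p x₁ ∨ r i = p x₂)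
    (hjz : r j = q z₁ ∨ r j = q z₂) : ∃ e, i < e ∧ e < j ∧ OnSeq ℓ q (r e) := by
  obtain ⟨e, hie, hej, hon, hno⟩ := exists_first_gt (A := fun s => OnSeq ℓ q (r s)) hij
    (h.swap.onSeq_x hjz)
  refine ⟨e, hie, lt_of_le_of_ne hej ?_, hon⟩
  rintro rfl
  obtain ⟨m, hm, hem⟩ := hon
  have := h.swap.leg_ear hx (by omega) hi hj hm hem.symm
    (fun s hs => hno s (by omega) (by omega))
  have := h.swap.dist_attach hz hjz hm hem.symm
  omega

lemma attach_gap (h : IsCrossing G ℓ k p q r a b x₁ x₂ z₁ z₂) (hx : x₂ ≤ x₁ + 2 * k)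
    (hz : z₂ ≤ z₁ + 2 * k) {i j : ℕ} (hij : i < j) (hj : j ≤ ℓ) (hi : r i = p x₁ ∨ r i = p x₂)
    (hjz : r j = q z₁ ∨ r j = q z₂) : i + 3 ≤ j := by
  obtain ⟨e, h₁, h₂, h₃, -⟩ := h.exists_last_fst hx hz hij hj hi hjz
  obtain ⟨f, h₄, h₅, h₆⟩ := h.exists_first_snd hx hz hij hj hi hjz
  have : e ≠ f := by
    rintro rfl
    exact h.not_on_all h₃ h₆ ⟨e, by omega, rfl⟩
  omega

lemma attach_iff {i : ℕ} :
    Attach p q r x₁ x₂ z₁ z₂ i ↔ (r i = p x₁ ∨ r i = p x₂) ∨ r i = q z₁ ∨ r i = q z₂ := by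
  unfold Attach
  tauto

/-- `i` and `j` are the positions of an attachment of `p` and one of `q`, and neighbours of
`r (i + 1)` are restricted as in `IsLongestSeq.neighbor_mem`. -/
structure Pinched (G : SimpleGraph V) (ℓ k : ℕ) (p q r : ℕ → V) (x₁ x₂ z₁ z₂ i j : ℕ) :
    Prop where
  attach_fst : r i = p x₁ ∨ r i = p x₂
  attach_snd : r j = q z₁ ∨ r j = q z₂
  lt : i + 2 < j
  le : j ≤ ℓ
  neighbor : ∀ c, G.Adj (r (i + 1)) c → c ∉ crossCore p q x₁ x₂ z₁ z₂ →
    ∃ e ≤ ℓ, r e = c ∧ (Attach p q r x₁ x₂ z₁ z₂ e ∨ (i ≤ e ∧ e ≤ j))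

/-- Every neighbour of `r (i + 1)` on `p` would be too far from the crossing. -/
lemma not_last_fst (h : IsCrossing G ℓ k p q r a b x₁ x₂ z₁ z₂) (hx : x₂ ≤ x₁ + 2 * k)
    (hz : z₂ ≤ z₁ + 2 * k) {i j : ℕ} (hP : Pinched G ℓ k p q r x₁ x₂ z₁ z₂ i j)
    (hon : OnSeq ℓ p (r (i + 1))) (hno : ∀ s, i + 1 < s → s < j → ¬ OnSeq ℓ p (r s)) : False := by
  have h₁ := h.x₁_lt
  have h₂ := h.lt_x₂
  have h₃ := h.x₂_le
  have h₄ := h.z₁_lt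
  have h₅ := h.lt_z₂
  have h₆ := h.z₂_le
  have hlt := hP.lt
  have hle := hP.le
  have hgx := h.gap_x
  have hgz := h.swap.gap_x
  obtain ⟨m, hm, hme⟩ := hon
  have hfar := h.leg_ear hz hle hP.attach_snd (show i + 1 ≤ ℓ by omega) hm hme.symm
    (fun s hs => hno s (by omega) (by omega))
  obtain ⟨m', hm', hadj, hm'a⟩ : ∃ m' ≤ ℓ, G.Adj (r (i + 1)) (p m') ∧
      k < (a - m') + (m' - a) := by
    rw [← hme]
    rcases hm.eq_or_lt with rfl | hml
    · refine ⟨m - 1, by omega, ?_, by omega⟩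
      have := h.fst.adj (m - 1) (by omega)
      rw [show m - 1 + 1 = m by omega] at this
      exact this.symm
    · exact ⟨m + 1, by omega, h.fst.adj m hml, by omega⟩
  have hatt : ∀ e ≤ ℓ, r e = p m' → ¬ Attach p q r x₁ x₂ z₁ z₂ e := by
    intro e he hem hA
    rcases attach_iff.1 hA with hA | hA
    · have := h.dist_attach hx hA hm' hem
      omega
    · exact h.not_on_all ⟨m', hm', hem.symm⟩ (h.swap.onSeq_x hA) ⟨e, he, rfl⟩
  obtain ⟨e, he, hem, hA | hA⟩ := hP.neighbor _ hadj (by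
    rintro (⟨t, ht, e⟩ | ⟨t, ht, e⟩)
    · have := h.fst.inj _ (by omega) _ hm' e
      omega
    · have hpt : OnSeq ℓ p (q t) := ⟨m', hm', e.symm⟩
      have := h.gap_snd t (by omega) z₁ (by omega) hpt h.on_z₁
      have := h.gap_snd t (by omega) z₂ (by omega) hpt h.on_z₂
      obtain rfl : t = b := by omega
      have := h.fst.inj _ (by omega) _ hm' (h.cross.trans e)
      omega)
  · exact hatt e he hem hA
  · have hei : e ≠ i := by
      rintro rfl
      exact hatt e he hem (attach_iff.2 (Or.inl hP.attach_fst))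
    have hej : e ≠ j := by
      rintro rfl
      exact hatt e he hem (attach_iff.2 (Or.inr hP.attach_snd))
    have hei' : e ≠ i + 1 := by
      rintro rfl
      exact hadj.ne hem
    exact hno e (by omega) (by omega) ⟨m', hm', hem.symm⟩

lemma not_first_snd (h : IsCrossing G ℓ 1 p q r a b x₁ x₂ z₁ z₂) (hx : x₂ ≤ x₁ + 2)
    (hz : z₂ ≤ z₁ + 2) {i : ℕ} (hP : Pinched G ℓ 1 p q r x₁ x₂ z₁ z₂ i (i + 3))
    (hq : OnSeq ℓ q (r (i + 1))) (hp : OnSeq ℓ p (r (i + 2))) : False := by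
  have h₁ := h.x₁_lt
  have h₂ := h.lt_x₂
  have h₃ := h.x₂_le
  have h₄ := h.z₁_lt
  have h₅ := h.lt_z₂
  have h₆ := h.z₂_le
  have hle := hP.le
  have hgx := h.gap_x
  have hgz := h.swap.gap_x
  have hiP : OnSeq ℓ p (r i) := h.onSeq_x hP.attach_fst
  have hbr : ¬ OnSeq ℓ r (q b) := h.off_z b h₄ h₅
  obtain ⟨m, hm, hme⟩ := hq
  have hmb : m ≠ b := by
    rintro rfl
    exact hbr ⟨i + 1, by omega, hme.symm⟩
  have hstep : ∀ m' ≤ ℓ, (m' = m + 1 ∨ m = m' + 1) → m' = z₁ ∨ m' = z₂ := by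
    intro m' hm' hmm'
    have hadj : G.Adj (q m) (q m') := by
      rcases hmm' with rfl | rfl
      exacts [h.snd.adj m (by omega), (h.snd.adj m' (by omega)).symm]
    have hatt : ∀ e ≤ ℓ, r e = q m' → Attach p q r x₁ x₂ z₁ z₂ e → m' = z₁ ∨ m' = z₂ := by
      intro e he hem hA
      rcases attach_iff.1 hA with hA | hA
      · exact (h.not_on_all (h.onSeq_x hA) ⟨m', hm', hem.symm⟩ ⟨e, he, rfl⟩).elim
      · rcases hA with hA | hA
        · exact Or.inl (h.snd.inj _ hm' _ (by omega) (hem.symm.trans hA))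
        · exact Or.inr (h.snd.inj _ hm' _ (by omega) (hem.symm.trans hA))
    obtain ⟨e, he, hem, hA | hA⟩ := hP.neighbor (q m') (hme ▸ hadj) (by
      have key : q m' ≠ q b := by
        intro e
        have := h.snd.inj _ hm' _ (by omega) e
        have hi' : Attach p q r x₁ x₂ z₁ z₂ (i + 1) := by
          refine attach_iff.2 (Or.inr ?_)
          rw [← hme]
          rcases (show m = z₁ ∨ m = z₂ by omega) with rfl | rfl
          exacts [Or.inl rfl, Or.inr rfl]
        have := h.attach_ear (by omega) (by omega) (by omega) hi'
          (attach_iff.2 (Or.inl hP.attach_fst))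
        omega
      rintro (⟨t, ht, e⟩ | ⟨t, ht, e⟩)
      · obtain rfl : t = a := by omega
        exact key (e.symm.trans h.cross)
      · obtain rfl : t = b := by omega
        exact key e.symm)
    · exact hatt e he hem hA
    · obtain rfl | rfl | rfl | rfl : e = i ∨ e = i + 1 ∨ e = i + 2 ∨ e = i + 3 := by omega
      · exact hatt _ he hem (attach_iff.2 (Or.inl hP.attach_fst))
      · exact (hadj.ne (hme.trans hem)).elim
      · exact (h.not_on_all hp ⟨m', hm', hem.symm⟩ ⟨i + 2, he, rfl⟩).elim
      · exact hatt _ he hem (attach_iff.2 (Or.inr hP.attach_snd))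
  have hpos : (m = 0 ∧ m < b) ∨ (m = ℓ ∧ b < m) := by
    by_cases hm₀ : m = 0
    · omega
    · have := hstep (m - 1) (by omega) (by omega)
      by_cases hml : m = ℓ
      · omega
      · have := hstep (m + 1) (by omega) (by omega)
        omega
  have hadj : G.Adj (r i) (q b) := by
    rw [← h.cross]
    rcases hP.attach_fst with e | e <;> rw [e]
    · have := h.fst.adj x₁ (by omega)
      rwa [show x₁ + 1 = a by omega] at this
    · have := h.fst.adj a (by omega)
      rw [show a + 1 = x₂ by omega] at this
      exact this.symm
  have key : ∀ t ≤ ℓ, (∀ s, ((b ≤ s ∧ s ≤ t) ∨ (t ≤ s ∧ s ≤ b)) → s ≤ ℓ ∧ s ≠ m) →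
      3 + ((b - t) + (t - b)) ≤ ℓ := by
    intro t ht hs
    have := h.trd.long _ _ _ _ ((h.trd.seg (show i + 2 ≤ ℓ by omega) (show i ≤ ℓ by omega)).link
      hadj (h.snd.seg (show b ≤ ℓ by omega) ht) (by
        rintro _ ⟨e, he, rfl⟩ ⟨s, hs', hse⟩
        have := hs s hs'
        obtain rfl | rfl | rfl : e = i ∨ e = i + 1 ∨ e = i + 2 := by omega
        · exact h.not_on_all hiP ⟨s, this.1, hse⟩ ⟨_, by omega, rfl⟩
        · exact this.2 (h.snd.inj _ this.1 _ hm (hse.trans hme.symm))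
        · exact h.not_on_all hp ⟨s, this.1, hse⟩ ⟨_, by omega, rfl⟩))
    omega
  rcases hpos with ⟨rfl, hmb'⟩ | ⟨rfl, hmb'⟩
  · have := key ℓ le_rfl (fun s hs => by omega)
    have := hstep 1 (by omega) (by omega)
    omega
  · have := key 0 (Nat.zero_le _) (fun s hs => by omega)
    have := hstep (m - 1) (by omega) (by omega)
    omega

lemma not_pinched (h : IsCrossing G ℓ k p q r a b x₁ x₂ z₁ z₂) (hx : x₂ ≤ x₁ + 2 * k)
    (hz : z₂ ≤ z₁ + 2 * k) {i j : ℕ} (hP : Pinched G ℓ k p q r x₁ x₂ z₁ z₂ i j)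
    (hij : j = i + k + 2) (hk : k ≤ 2) : False := by
  have hpos := h.pos
  have hlt := hP.lt
  have hle := hP.le
  obtain ⟨e, h₁, h₂, h₃, h₄⟩ := h.exists_last_fst hx hz (by omega) hle hP.attach_fst hP.attach_snd
  obtain ⟨f, h₅, h₆, h₇⟩ := h.exists_first_snd hx hz (by omega) hle hP.attach_fst hP.attach_snd
  have hef := h.gap_trd e (by omega) f (by omega) h₃ h₇
  have hif := h.gap_trd i (by omega) f (by omega) (h.onSeq_x hP.attach_fst) h₇
  by_cases hei : e = i + 1
  · subst hei
    exact h.not_last_fst hx hz hP h₃ h₄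
  · obtain rfl : k = 1 := by omega
    obtain rfl : e = i + 2 := by omega
    obtain rfl : f = i + 1 := by omega
    subst hij
    exact h.not_first_snd hx hz hP h₇ h₃

/-- The attachments of `p` and of `q` in increasing order of their positions on `r`. -/
lemma exists_sorted_positions (h : IsCrossing G ℓ k p q r a b x₁ x₂ z₁ z₂) :
    ∃ X Y Z W, X < Y ∧ Y ≤ ℓ ∧ Z < W ∧ W ≤ ℓ ∧ X ≠ Z ∧ X ≠ W ∧ Y ≠ Z ∧ Y ≠ W ∧
      (r X = p x₁ ∨ r X = p x₂) ∧ (r Y = p x₁ ∨ r Y = p x₂) ∧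
      (r Z = q z₁ ∨ r Z = q z₂) ∧ (r W = q z₁ ∨ r W = q z₂) := by
  obtain ⟨X₁, X₂, Z₁, Z₂, ⟨l₁, l₂, l₃, l₄⟩, ⟨e₁, e₂, e₃, e₄⟩, n₁, n₂, n₃, n₄, n₅, n₆⟩ :=
    h.exists_positions
  rcases lt_or_gt_of_ne n₁ with hX | hX <;> rcases lt_or_gt_of_ne n₆ with hZ | hZ
  · exact ⟨X₁, X₂, Z₁, Z₂, hX, l₂, hZ, l₄, n₂, n₃, n₄, n₅, .inl e₁, .inr e₂, .inl e₃, .inr e₄⟩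
  · exact ⟨X₁, X₂, Z₂, Z₁, hX, l₂, hZ, l₃, n₃, n₂, n₅, n₄, .inl e₁, .inr e₂, .inr e₄, .inl e₃⟩
  · exact ⟨X₂, X₁, Z₁, Z₂, hX, l₁, hZ, l₄, n₄, n₅, n₂, n₃, .inr e₂, .inl e₁, .inl e₃, .inr e₄⟩
  · exact ⟨X₂, X₁, Z₂, Z₁, hX, l₁, hZ, l₃, n₅, n₄, n₃, n₂, .inr e₂, .inl e₁, .inr e₄, .inl e₃⟩

lemma not_small_of_lt (h : IsCrossing G ℓ k p q r a b x₁ x₂ z₁ z₂) (hx : x₂ ≤ x₁ + 2 * k)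
    (hz : z₂ ≤ z₁ + 2 * k) (hk : (k = 1 ∧ ℓ ≤ 9) ∨ (k = 2 ∧ ℓ = 18)) {X Y Z W : ℕ} (hXY : X < Y)
    (hY : Y ≤ ℓ) (hZW : Z < W) (hW : W ≤ ℓ) (hXZ : X < Z) (hXW : X ≠ W) (hYZ : Y ≠ Z) (hYW : Y ≠ W)
    (pX : r X = p x₁ ∨ r X = p x₂) (pY : r Y = p x₁ ∨ r Y = p x₂)
    (pZ : r Z = q z₁ ∨ r Z = q z₂) (pW : r W = q z₁ ∨ r W = q z₂) : False := by
  have aX : Attach p q r x₁ x₂ z₁ z₂ X := attach_iff.2 (Or.inl pX)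
  have aY : Attach p q r x₁ x₂ z₁ z₂ Y := attach_iff.2 (Or.inl pY)
  have aZ : Attach p q r x₁ x₂ z₁ z₂ Z := attach_iff.2 (Or.inr pZ)
  have aW : Attach p q r x₁ x₂ z₁ z₂ W := attach_iff.2 (Or.inr pW)
  have d₁ := h.attach_ear (by omega) hY hXY.ne aX aY
  have d₂ := h.attach_ear (by omega) (by omega) hXZ.ne aX aZ
  have d₃ := h.attach_ear (by omega) hW hXW aX aW
  have d₄ := h.attach_ear hY (by omega) hYZ aY aZ
  have d₅ := h.attach_ear hY hW hYW aY aW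
  have d₆ := h.attach_ear (by omega) hW hZW.ne aZ aW
  have d₇ := h.attach_ear hW (by omega) hZW.ne' aW aZ
  have gap : ∀ {i j}, i ≤ ℓ → j ≤ ℓ → i ≠ j → (r i = p x₁ ∨ r i = p x₂) →
      (r j = q z₁ ∨ r j = q z₂) → 3 ≤ (i - j) + (j - i) := by
    intro i j hi hj hij pi pj
    rcases lt_or_gt_of_ne hij with hij | hij
    · have := h.attach_gap hx hz hij hj pi pj
      omega
    · have := h.swap.attach_gap hz hx hij hi pj pi
      omega
  have g₁ := gap (by omega) (by omega) hXZ.ne pX pZ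
  have g₂ := gap (by omega) hW hXW pX pW
  have g₃ := gap hY (by omega) hYZ pY pZ
  have g₄ := gap hY hW hYW pY pW
  have main : ∀ i, i < Z → (r i = p x₁ ∨ r i = p x₂) → Z = i + k + 2 →
      (∃ t, Attach p q r x₁ x₂ z₁ z₂ t ∧ t ≤ ℓ ∧ i < t ∧ ℓ < 2 * k + t) →
      (∀ e ≤ ℓ, ¬ Attach p q r x₁ x₂ z₁ z₂ e → (e < i ∨ Z < e) → (e < i ∧ e < 2 * k - 1) ∨
        (∃ t, Attach p q r x₁ x₂ z₁ z₂ t ∧ t < e ∧ e < i ∧ e < 2 * k + t) ∨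
        ∃ t, Attach p q r x₁ x₂ z₁ z₂ t ∧ i < t ∧ t < e ∧ e < 2 * k + t) → False := by
    intro i hi pi hij hend hcov
    have hkk : 2 * k - 1 + 1 = 2 * k := by omega
    refine h.not_pinched hx hz (i := i) (j := Z) ⟨pi, pZ, by omega, by omega, fun c hc hcS => ?_⟩
      hij (by omega)
    obtain ⟨e, he, hec, hA⟩ := h.trd.neighbor_mem h.not_onSeq_core
      (A := fun e => e ≤ ℓ ∧ Attach p q r x₁ x₂ z₁ z₂ e) (n := 2 * k - 1) (i := i) (j := Z)
      (fun _ h => h.1)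
      (fun i j hi hj hij => h.bridges (fun e => hij (h.trd.inj _ hi.1 _ hj.1 e)) hi.2 hj.2)
      ⟨by omega, attach_iff.2 (Or.inl pi)⟩ ⟨by omega, aZ⟩ hi
      (by
        obtain ⟨t, h₁, h₂, h₃, h₄⟩ := hend
        exact ⟨t, ⟨h₂, h₁⟩, h₃, by omega⟩)
      (by
        intro e he hA hout
        rcases hcov e he (fun hA' => hA ⟨he, hA'⟩) hout with h₁ | ⟨t, h₁, h₂, h₃, h₄⟩ |
          ⟨t, h₁, h₂, h₃, h₄⟩
        · exact Or.inl h₁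
        · exact Or.inr (Or.inl ⟨t, ⟨by omega, h₁⟩, h₂, h₃, by omega⟩)
        · exact Or.inr (Or.inr ⟨t, ⟨by omega, h₁⟩, h₂, h₃, by omega⟩))
      hc hcS
    exact ⟨e, he, hec, hA.imp And.right id⟩
  have ne : ∀ {e t}, ¬ Attach p q r x₁ x₂ z₁ z₂ e → Attach p q r x₁ x₂ z₁ z₂ t → e ≠ t := by
    rintro e t he ht rfl
    exact he ht
  rcases lt_or_gt_of_ne hYZ with hYZ' | hYZ'
  · refine main Y hYZ' pY (by omega) ⟨W, aW, hW, by omega, by omega⟩ fun e he hA hout => ?_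
    have := ne hA aX
    have := ne hA aW
    by_cases h₁ : W < e
    · exact Or.inr (Or.inr ⟨W, aW, by omega, h₁, by omega⟩)
    by_cases h₂ : Z < e
    · exact Or.inr (Or.inr ⟨Z, aZ, by omega, h₂, by omega⟩)
    by_cases h₃ : X < e
    · exact Or.inr (Or.inl ⟨X, aX, h₃, by omega, by omega⟩)
    · exact Or.inl (by omega)
  · refine main X hXZ pX (by omega) ?_ fun e he hA hout => ?_
    · rcases lt_or_gt_of_ne hYW with h' | h'
      exacts [⟨W, aW, hW, by omega, by omega⟩, ⟨Y, aY, hY, by omega, by omega⟩]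
    · have := ne hA aY
      have := ne hA aW
      by_cases h₀ : e < X
      · exact Or.inl (by omega)
      refine Or.inr (Or.inr ?_)
      by_cases h₁ : Y < e ∧ e < 2 * k + Y
      · exact ⟨Y, aY, by omega, h₁.1, h₁.2⟩
      by_cases h₂ : W < e ∧ e < 2 * k + W
      · exact ⟨W, aW, by omega, h₂.1, h₂.2⟩
      · exact ⟨Z, aZ, by omega, by omega, by omega⟩

lemma not_small (h : IsCrossing G ℓ k p q r a b x₁ x₂ z₁ z₂) (hx : x₂ ≤ x₁ + 2 * k)
    (hz : z₂ ≤ z₁ + 2 * k) (hk : (k = 1 ∧ ℓ ≤ 9) ∨ (k = 2 ∧ ℓ = 18)) : False := by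
  obtain ⟨X, Y, Z, W, h₁, h₂, h₃, h₄, h₅, h₆, h₇, h₈, pX, pY, pZ, pW⟩ := h.exists_sorted_positions
  rcases lt_or_gt_of_ne h₅ with hXZ | hXZ
  · exact h.not_small_of_lt hx hz hk h₁ h₂ h₃ h₄ hXZ h₆ h₇ h₈ pX pY pZ pW
  · exact h.swap.not_small_of_lt hz hx hk h₃ h₄ h₁ h₂ hXZ h₇.symm h₆.symm h₈.symm pZ pW pX pY

theorem bound [Fintype V] (h : IsCrossing G ℓ k p q r a b x₁ x₂ z₁ z₂) :
    17 * k ≤ Fintype.card V := by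
  rcases Nat.lt_or_ge (x₁ + 2 * k) x₂ with hx | hx
  · exact h.bound_of_long hx
  rcases Nat.lt_or_ge (z₁ + 2 * k) z₂ with hz | hz
  · exact h.swap.bound_of_long hz
  exact (h.bound_of_short hx hz).resolve_right (h.not_small hx hz)

end IsCrossing

namespace IsLongestSeq

variable {V : Type*} {G : SimpleGraph V} {ℓ : ℕ} {p q : ℕ → V}

lemma dist_le (hp : IsLongestSeq G ℓ p) (hG : G.Connected) {s t : ℕ} (hs : s ≤ ℓ) (ht : t ≤ ℓ) :
    G.dist (p s) (p t) ≤ (s - t) + (t - s) := by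
  have key : ∀ s t, s ≤ t → t ≤ ℓ → G.dist (p s) (p t) ≤ t - s := by
    intro s t hst
    induction t, hst using Nat.le_induction with
    | base => simp
    | succ t hst ih =>
      intro ht
      have := ih (by omega)
      have := hG.dist_triangle (u := p s) (v := p t) (w := p (t + 1))
      have := (SimpleGraph.dist_eq_one_iff_adj).2 (hp.adj t (by omega))
      omega
  rcases le_total s t with h | h
  · have := key s t h ht
    omega
  · have := key t s h hs
    rw [SimpleGraph.dist_comm] at this
    omega

/-- Two longest paths of a connected graph have a common vertex. -/
lemma exists_meet (hp : IsLongestSeq G ℓ p) (hq : IsLongestSeq G ℓ q) (hG : G.Connected) :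
    ∃ s ≤ ℓ, ∃ t ≤ ℓ, p s = q t := by
  by_contra! hno
  obtain ⟨⟨s, t⟩, hst, hmin⟩ := Finset.exists_min_image
    (Finset.range (ℓ + 1) ×ˢ Finset.range (ℓ + 1)) (fun x => G.dist (p x.1) (q x.2))
    ⟨(0, 0), by simp⟩
  simp only [Finset.mem_product, Finset.mem_range, Nat.lt_succ_iff, Prod.forall] at hst hmin
  obtain ⟨w, hw, hlen⟩ := hG.exists_path_of_dist (p s) (q t)
  have hwp : ∀ x ∈ w.support, OnSeq ℓ p x → x = p s := by
    classical
    rintro _ hx ⟨s', hs', rfl⟩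
    have h₁ := hmin s' t ⟨hs', hst.2⟩
    have h₂ := SimpleGraph.dist_le (w.dropUntil _ hx)
    have h₃ := congrArg Walk.length (w.take_spec hx)
    rw [Walk.length_append] at h₃
    exact (Walk.eq_of_length_eq_zero (p := w.takeUntil _ hx) (by omega)).symm
  have hwq : ∀ x ∈ w.support, OnSeq ℓ q x → x = q t := by
    classical
    rintro _ hx ⟨t', ht', rfl⟩
    have h₁ := hmin s t' ⟨hst.1, ht'⟩
    have h₂ := SimpleGraph.dist_le (w.takeUntil _ hx)
    have h₃ := congrArg Walk.length (w.take_spec hx)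
    rw [Walk.length_append] at h₃
    exact Walk.eq_of_length_eq_zero (p := w.dropUntil _ hx) (by omega)
  have hpath : PathWithin G (p s) (q t) w.length {x | x ∈ w.support} :=
    ⟨w, hw, le_rfl, fun _ h => h⟩
  have key : ∀ e ≤ ℓ, w.length + ((t - e) + (e - t)) ≤ s ∧
      w.length + ((t - e) + (e - t)) + s ≤ ℓ := by
    intro e he
    refine hp.half_ear hst.1 (hpath.glue (hq.seg hst.2 he) ?_) ?_
    · rintro x hx ⟨t', ht', rfl⟩
      exact hwq _ hx ⟨t', by omega, rfl⟩
    · rintro _ (hx | ⟨t', ht', rfl⟩) hon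
      · exact hwp _ hx hon
      · obtain ⟨s', hs', e'⟩ := hon
        exact (hno s' hs' t' (by omega) e').elim
  have h₁ := key 0 (Nat.zero_le ℓ)
  have h₂ := key ℓ le_rfl
  exact hno s hst.1 t hst.2 (Walk.eq_of_length_eq_zero (p := w) (by omega))

end IsLongestSeq

lemma IsLongestPath.isLongestSeq {V : Type*} {G : SimpleGraph V} {u v : V} {w : G.Walk u v}
    (h : IsLongestPath G w) {ℓ : ℕ} (hℓ : w.length = ℓ) : IsLongestSeq G ℓ w.getVert := by
  subst hℓ
  refine ⟨fun s hs t ht e => h.1.getVert_injOn hs ht e, fun t ht => w.adj_getVert_succ ht, ?_⟩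
  rintro a b n S ⟨q, hq, hn, -⟩
  exact hn.trans (h.2 a b q hq)

lemma onSeq_getVert_iff {V : Type*} {G : SimpleGraph V} {u v x : V} {w : G.Walk u v} {ℓ : ℕ}
    (hℓ : w.length = ℓ) : OnSeq ℓ w.getVert x ↔ x ∈ w.support := by
  subst hℓ
  rw [Walk.mem_support_iff_exists_getVert]
  exact ⟨fun ⟨t, ht, e⟩ => ⟨t, e, ht⟩, fun ⟨t, e, ht⟩ => ⟨t, ht, e⟩⟩

lemma distToWalk_le {V : Type*} {G : SimpleGraph V} {u v x y : V} {w : G.Walk u v}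
    (hy : y ∈ w.support) : distToWalk G x w ≤ G.dist x y := Nat.sInf_le ⟨y, hy, rfl⟩

lemma pdf_le {V : Type*} {G : SimpleGraph V} {k : ℕ} (P : Fin k → Σ u : V, Σ v : V, G.Walk u v)
    (x : V) : pdf G P ≤ ∑ i, distToWalk G x (P i).2.2 := Nat.sInf_le ⟨x, rfl⟩

lemma spreadTriple_pdf {V : Type*} {G : SimpleGraph V} (hG : G.Connected)
    (P : Fin 3 → Σ u : V, Σ v : V, G.Walk u v) (hlong : ∀ i, IsLongestPath G (P i).2.2)
    (hpos : 1 ≤ pdf G P) :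
    SpreadTriple G (P 0).2.2.length (pdf G P) (P 0).2.2.getVert (P 1).2.2.getVert
      (P 2).2.2.getVert := by
  set ℓ := (P 0).2.2.length
  have hlen : ∀ i, (P i).2.2.length = ℓ := fun i =>
    le_antisymm ((hlong 0).2 _ _ _ (hlong i).1) ((hlong i).2 _ _ _ (hlong 0).1)
  have hseq : ∀ i, IsLongestSeq G ℓ (P i).2.2.getVert := fun i => (hlong i).isLongestSeq (hlen i)
  have hgap : ∀ i j l, (∀ f : Fin 3 → ℕ, ∑ m, f m = f i + f j + f l) → ∀ s ≤ ℓ, ∀ t ≤ ℓ,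
      OnSeq ℓ (P j).2.2.getVert ((P i).2.2.getVert s) →
      OnSeq ℓ (P l).2.2.getVert ((P i).2.2.getVert t) → pdf G P ≤ (s - t) + (t - s) := by
    intro i j l hsum s hs t ht hj hl
    have h₁ := pdf_le P ((P i).2.2.getVert s)
    rw [hsum] at h₁
    have h₂ := distToWalk_le (x := (P i).2.2.getVert s)
      ((onSeq_getVert_iff (hlen i)).1 ⟨s, hs, rfl⟩)
    have h₃ := distToWalk_le (x := (P i).2.2.getVert s) ((onSeq_getVert_iff (hlen j)).1 hj)
    have h₄ := distToWalk_le (x := (P i).2.2.getVert s) ((onSeq_getVert_iff (hlen l)).1 hl)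
    have h₅ := (hseq i).dist_le hG hs ht
    rw [SimpleGraph.dist_self] at h₂ h₃
    omega
  exact {
    pos := hpos
    fst := hseq 0
    snd := hseq 1
    trd := hseq 2
    gap_fst := hgap 0 1 2 fun f => Fin.sum_univ_three f
    gap_snd := hgap 1 0 2 fun f => by rw [Fin.sum_univ_three, add_comm (f 0)]
    gap_trd := fun s hs t ht h₁ h₂ => hgap 2 0 1 (fun f => by rw [Fin.sum_univ_three]; ring)
      s hs t ht h₁ h₂
    meet_fst_snd := (hseq 0).exists_meet (hseq 1) hG
    meet_fst_trd := (hseq 0).exists_meet (hseq 2) hG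
    meet_snd_trd := (hseq 1).exists_meet (hseq 2) hG }

/-- Theorem 1 (Fujita et al.): for three longest paths, `17·f(G,𝒫) ≤ n`. -/
theorem three_longest_paths_bound {V : Type*} [Fintype V] (G : SimpleGraph V)
    (hG : G.Connected) (P : Fin 3 → Σ u : V, Σ v : V, G.Walk u v)
    (hinj : Function.Injective P) (hlong : ∀ i, IsLongestPath G (P i).2.2) :
    17 * pdf G P ≤ Fintype.card V := by
  rcases Nat.eq_zero_or_pos (pdf G P) with h | h
  · omega
  · obtain ⟨p, q, r, a, b, x₁, x₂, z₁, z₂, hc⟩ := (spreadTriple_pdf hG P hlong h).exists_crossing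
    exact hc.bound
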